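/- arXiv:2012.15011 — 2 statements merged into one kernel-verified Lean document; each statement's English description precedes it below -/
import Mathlib

section
/- Let ν be a partition with exactly ℓ = ℓ(ν) positive parts, let x = (x_1,…,x_n), and let t̃ = (t_1,…,t_m) with m ≥ ℓ−1. Then s_ν(x_1,…,x_n, t_1,…,t_m) = Σ_{λ ⊆ ν} p_ν^λ(t̃) · g_λ(x; t_1,…,t_{ℓ(λ)−1}), where the sum is over all partitions λ with λ_i ≤ ν_i for all i, and p_ν^λ(t̃) = det[ h_{ν_i − λ_j − i + j}(t_j, t_{j+1}, …, t_m) ]_{i,j=1}^{ℓ}, the (i,j) entry being the complete homogeneous symmetric polynomial of degree ν_i − λ_j − i + j in the variables t_j, t_{j+1}, …, t_m (an empty variable set gives h_k = δ_{k,0}, and h_d = 0 for d < 0). -/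
open scoped Classical

noncomputable section

variable {R : Type*} [CommRing R]

/-- The boxes of the Young diagram with row lengths `lam 0, …, lam (ℓ-1)`
(a box in row `r < ℓ` and column `c < lam r`, both 0-indexed). -/
abbrev YBox (ℓ : ℕ) (lam : ℕ → ℕ) : Type := Σ r : Fin ℓ, Fin (lam r.1)

/-- A reverse plane partition of skew shape `lam/mu` with entries in `{1, …, n}`,
encoded as a filling of the boxes of `lam` by values in `Fin (n+1)`, where the
value `0` is used exactly on the boxes of `mu`; rows weakly increase and
columns weakly increase. -/
def IsSkewRPP (ℓ n : ℕ) (lam mu : ℕ → ℕ) (T : YBox ℓ lam → Fin (n + 1)) : Prop :=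
  (∀ b : YBox ℓ lam, ((T b : ℕ) = 0 ↔ (b.2 : ℕ) < mu b.1.1)) ∧
  (∀ (r : Fin ℓ) (c c' : Fin (lam r.1)), mu r.1 ≤ (c : ℕ) → (c : ℕ) ≤ (c' : ℕ) →
    T ⟨r, c⟩ ≤ T ⟨r, c'⟩) ∧
  (∀ (r r' : Fin ℓ) (c : Fin (lam r.1)) (c' : Fin (lam r'.1)),
    (r : ℕ) ≤ (r' : ℕ) → (c : ℕ) = (c' : ℕ) → mu r.1 ≤ (c : ℕ) → mu r'.1 ≤ (c' : ℕ) →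
    T ⟨r, c⟩ ≤ T ⟨r', c'⟩)

/-- The weight of a box `b` of the skew shape `lam/mu` in a reverse plane
partition `T`: it is `t (r+1)` (`r+1` being the 1-indexed row of `b`) if the box
directly below `b` exists (in `lam`) and carries the same entry, and `x e`
otherwise, where `e ∈ {1, …, n}` is the entry of `b`.  Boxes of `mu` have
weight `1`. -/
def boxWeight (ℓ n : ℕ) (lam mu : ℕ → ℕ) (x t : ℕ → R)
    (T : YBox ℓ lam → Fin (n + 1)) (b : YBox ℓ lam) : R :=
  if mu b.1.1 ≤ (b.2 : ℕ) then
    if ∃ (hr : (b.1 : ℕ) + 1 < ℓ) (hc : (b.2 : ℕ) < lam ((b.1 : ℕ) + 1)),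
        T ⟨⟨(b.1 : ℕ) + 1, hr⟩, ⟨(b.2 : ℕ), hc⟩⟩ = T b
      then t ((b.1 : ℕ) + 1)
      else x (T b : ℕ)
  else 1

/-- The (skew) refined dual Grothendieck polynomial `g_{lam/mu}(x; t)`:
the sum of `∏_r t_r^{b_r(T)} ∏_i x_i^{a_i(T)}` over all reverse plane
partitions `T` of shape `lam/mu` with entries in `{1, …, n}`, where `b_r(T)`
is the number of boxes in row `r` whose entry equals that of the box directly
below it, and `a_i(T)` is the number of columns containing the entry `i`. -/
def dualGroth (ℓ n : ℕ) (lam mu : ℕ → ℕ) (x t : ℕ → R) : R :=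
  ∑ T ∈ Finset.univ.filter (IsSkewRPP ℓ n lam mu),
    ∏ b : YBox ℓ lam, boxWeight ℓ n lam mu x t T b

/-- Complete homogeneous symmetric function `h_k` of the entries of a list. -/
def hL (k : ℕ) (L : List R) : R :=
  ∑ f ∈ Finset.univ.filter (fun f : Fin k → Fin L.length => Monotone f),
    ∏ i, L.get (f i)

/-- Elementary symmetric function `e_k` of the entries of a list. -/
def eL (k : ℕ) (L : List R) : R :=
  ∑ f ∈ Finset.univ.filter (fun f : Fin k → Fin L.length => StrictMono f),
    ∏ i, L.get (f i)

/-- `h_d` for an integer degree `d`, with `h_d = 0` for `d < 0`. -/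
def hInt (d : ℤ) (L : List R) : R := if 0 ≤ d then hL d.toNat L else 0

/-- `e_d` for an integer degree `d`, with `e_d = 0` for `d < 0`. -/
def eInt (d : ℤ) (L : List R) : R := if 0 ≤ d then eL d.toNat L else 0

/-- Extend a function on `Fin ℓ` to `ℕ` by `0`. -/
def extendFin (ℓ : ℕ) (p : Fin ℓ → ℕ) : ℕ → ℕ :=
  fun r => if h : r < ℓ then p ⟨r, h⟩ else 0

/-- A semistandard Young tableau of shape `lam` with entries in `{1, …, N}`
(encoded with values in `Fin (N+1)`, the value `0` being unused): rows weakly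
increase and columns strictly increase. -/
def IsSSYT (ℓ N : ℕ) (lam : ℕ → ℕ) (T : YBox ℓ lam → Fin (N + 1)) : Prop :=
  (∀ b : YBox ℓ lam, 1 ≤ (T b : ℕ)) ∧
  (∀ (r : Fin ℓ) (c c' : Fin (lam r.1)), (c : ℕ) ≤ (c' : ℕ) → T ⟨r, c⟩ ≤ T ⟨r, c'⟩) ∧
  (∀ (r r' : Fin ℓ) (c : Fin (lam r.1)) (c' : Fin (lam r'.1)),
    (r : ℕ) < (r' : ℕ) → (c : ℕ) = (c' : ℕ) → T ⟨r, c⟩ < T ⟨r', c'⟩)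

/-- The Schur polynomial `s_lam (z 1, …, z N)`: the sum of `z^T` over all
semistandard Young tableaux of shape `lam` with entries in `{1, …, N}`. -/
def schurPoly (ℓ N : ℕ) (lam : ℕ → ℕ) (z : ℕ → R) : R :=
  ∑ T ∈ Finset.univ.filter (IsSSYT ℓ N lam),
    ∏ b : YBox ℓ lam, z (T b : ℕ)


/-- Extend a dependent tuple `p i ≤ nu i` (a partition `λ ⊆ ν`) to a function
`ℕ → ℕ`, by `0` outside `Fin ℓ`. -/
def extendDep (ℓ : ℕ) (nu : ℕ → ℕ) (p : (i : Fin ℓ) → Fin (nu i.1 + 1)) : ℕ → ℕ :=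
  fun r => if h : r < ℓ then (p ⟨r, h⟩ : ℕ) else 0

/-- Strictly increasing sequences of length `k` with values in `[c, N)`. -/
def incSeq (N k c : ℕ) : Finset (Fin k → ℕ) :=
  (Fintype.piFinset fun _ : Fin k => Finset.Ico c N).filter StrictMono

theorem mem_incSeq {N k c : ℕ} {a : Fin k → ℕ} :
    a ∈ incSeq N k c ↔ (∀ i, c ≤ a i ∧ a i < N) ∧ StrictMono a := by
  simp [incSeq]

theorem incSeq_zero (N c : ℕ) : incSeq N 0 c = {![]} := by
  ext a
  simp only [mem_incSeq, Finset.mem_singleton]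
  exact ⟨fun _ => Subsingleton.elim _ _, fun _ => ⟨fun i => i.elim0, fun i => i.elim0⟩⟩

theorem sum_incSeq_succ {M : Type*} [AddCommMonoid M] (N k c : ℕ) (f : (Fin (k + 1) → ℕ) → M) :
    ∑ a ∈ incSeq N (k + 1) c, f a =
      ∑ b ∈ Finset.Ico c N, ∑ q ∈ incSeq N k (b + 1), f (Matrix.vecCons b q) := by
  rw [Finset.sum_sigma']
  refine Finset.sum_nbij' (fun a => ⟨a 0, fun i => a i.succ⟩)
    (fun s => Matrix.vecCons s.1 s.2) ?_ ?_ ?_ ?_ ?_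
  · intro a ha
    obtain ⟨h1, h2⟩ := mem_incSeq.1 ha
    simp only [Finset.mem_sigma, Finset.mem_Ico, mem_incSeq]
    exact ⟨h1 0, fun i => ⟨h2 (Fin.succ_pos i), (h1 _).2⟩,
      fun i j hij => h2 (Fin.succ_lt_succ_iff.2 hij)⟩
  · rintro ⟨b, q⟩ hs
    simp only [Finset.mem_sigma, Finset.mem_Ico, mem_incSeq] at hs
    obtain ⟨⟨hb, hN⟩, hq, hm⟩ := hs
    rw [mem_incSeq]
    refine ⟨fun i => ?_, ?_⟩
    · refine Fin.cases ⟨hb, hN⟩ (fun i => ?_) i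
      have := hq i
      simp only [Matrix.cons_val_succ]
      omega
    · intro i j hij
      induction i using Fin.cases with
      | zero =>
        induction j using Fin.cases with
        | zero => exact absurd hij (lt_irrefl _)
        | succ j => have := hq j; simp only [Matrix.cons_val_zero, Matrix.cons_val_succ]; omega
      | succ i =>
        induction j using Fin.cases with
        | zero => exact absurd hij (Fin.not_lt_zero _)
        | succ j => simpa using hm (Fin.succ_lt_succ_iff.1 hij)
  · intro a _
    exact Matrix.cons_head_tail a
  · intro s _
    simp
  · intro a _
    exact congrArg f (Matrix.cons_head_tail a).symm

/-- The Cauchy–Binet formula. -/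
theorem cauchy_binet {W : Type*} [AddCommGroup W] [Module R W] (k N : ℕ)
    (ψ : W [⋀^Fin k]→ₗ[R] R) (C : Fin k → ℕ → R) (B : ℕ → W) :
    ψ (fun i => ∑ a ∈ Finset.range N, C i a • B a) =
      ∑ a ∈ incSeq N k 0, Matrix.det (Matrix.of fun i j => C i (a j)) * ψ (fun j => B (a j)) := by
  have h1 : ψ (fun i => ∑ a ∈ Finset.range N, C i a • B a) =
      ∑ f ∈ Fintype.piFinset fun _ : Fin k => Finset.range N,
        (∏ i, C i (f i)) * ψ (fun j => B (f j)) := by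
    rw [← AlternatingMap.coe_multilinearMap, MultilinearMap.map_sum_finset]
    refine Finset.sum_congr rfl fun f _ => ?_
    rw [MultilinearMap.map_smul_univ, smul_eq_mul]
  have h2 : ∀ f ∈ Fintype.piFinset fun _ : Fin k => Finset.range N,
      (∏ i, C i (f i)) * ψ (fun j => B (f j)) ≠ 0 → Function.Injective f := by
    intro f _ hf
    by_contra hinj
    simp only [Function.Injective, not_forall] at hinj
    obtain ⟨i, j, hij, hne⟩ := hinj
    exact hf (by rw [ψ.map_eq_zero_of_eq _ (by rw [hij]) hne, mul_zero])
  rw [h1, ← Finset.sum_filter_of_ne h2]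
  have h3 : ∀ a ∈ incSeq N k 0,
      Matrix.det (Matrix.of fun i j => C i (a j)) * ψ (fun j => B (a j)) =
        ∑ σ : Equiv.Perm (Fin k), (∏ i, C i (a (σ i))) * ψ (fun j => B (a (σ j))) := by
    intro a _
    rw [← Matrix.det_transpose, Matrix.det_apply', Finset.sum_mul]
    refine Finset.sum_congr rfl fun σ _ => ?_
    have := ψ.map_perm (fun j => B (a j)) σ
    simp only [Function.comp_def] at this
    rw [this, Units.smul_def, zsmul_eq_mul]
    simp only [Matrix.transpose_apply, Matrix.of_apply]
    ring
  rw [Finset.sum_congr rfl h3, ← Finset.sum_product']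
  symm
  refine Finset.sum_nbij (fun s => fun i => s.1 (s.2 i)) ?_ ?_ ?_ ?_
  · rintro ⟨a, σ⟩ hs
    simp only [Finset.mem_product, mem_incSeq, Finset.mem_univ, and_true] at hs
    simp only [Finset.mem_filter, Fintype.mem_piFinset, Finset.mem_range]
    exact ⟨fun i => (hs.1 _).2, hs.2.injective.comp σ.injective⟩
  · rintro ⟨a, σ⟩ hs ⟨b, τ⟩ ht hst
    simp only [Finset.coe_product, Set.mem_prod, Finset.mem_coe, mem_incSeq] at hs ht
    have hst' : a ∘ σ = b ∘ τ := hst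
    have hr : Set.range a = Set.range b := by
      rw [← σ.surjective.range_comp a, ← τ.surjective.range_comp b, hst']
    have hab : a = b := (hs.1.2.range_inj ht.1.2).1 hr
    subst hab
    simp only [Prod.mk.injEq, true_and]
    exact Equiv.ext fun i => hs.1.2.injective (congrFun hst i)
  · intro f hf
    simp only [Finset.coe_filter, Fintype.mem_piFinset, Finset.mem_range, Set.mem_ofPred_eq] at hf
    refine ⟨(f ∘ Tuple.sort f, (Tuple.sort f)⁻¹), ?_, ?_⟩
    · simp only [Finset.coe_product, Set.mem_prod, Finset.mem_coe, mem_incSeq, Finset.mem_univ,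
        and_true]
      exact ⟨fun i => ⟨Nat.zero_le _, hf.1 _⟩,
        (Tuple.monotone_sort f).strictMono_of_injective (hf.2.comp (Tuple.sort f).injective)⟩
    · funext i
      simp
  · intro s _
    rfl

section Flags

variable {V W : Type*} [AddCommGroup V] [Module R V] [AddCommGroup W] [Module R W]

theorem vecCons_comp {X : Type*} {k : ℕ} (A : ℕ → X) (b : ℕ) (q : Fin k → ℕ) :
    (fun i => A (Matrix.vecCons b q i)) = Matrix.vecCons (A b) fun i => A (q i) := by
  funext i
  induction i using Fin.cases <;> simp

theorem vecCons_comp_level {X : Type*} {k : ℕ} (A : ℕ → ℕ → X) (s b : ℕ) (q : Fin k → ℕ) :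
    (fun i : Fin (k + 1) => A (s + i) (Matrix.vecCons b q i)) =
      Matrix.vecCons (A s b) fun i : Fin k => A (s + 1 + i) (q i) := by
  funext i
  induction i using Fin.cases with
  | zero => simp
  | succ i => simp [add_assoc, add_comm 1]

/-- The pairing `∑ φ(A(a_0), A(a_1), …) ψ(B(a_0), B(a_1), …)` over increasing sequences. -/
def pairSum (N k c : ℕ) (A : ℕ → V) (B : ℕ → W)
    (φ : V [⋀^Fin k]→ₗ[R] R) (ψ : W [⋀^Fin k]→ₗ[R] R) : R :=
  ∑ a ∈ incSeq N k c, φ (fun i => A (a i)) * ψ (fun i => B (a i))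

/-- The pairing over increasing sequences in which the `i`-th vectors are taken from the
`(s + i)`-th members of the families `A` and `B`. -/
def flagSum (N k s c : ℕ) (A : ℕ → ℕ → V) (B : ℕ → ℕ → W)
    (φ : V [⋀^Fin k]→ₗ[R] R) (ψ : W [⋀^Fin k]→ₗ[R] R) : R :=
  ∑ a ∈ incSeq N k c, φ (fun i => A (s + i) (a i)) * ψ (fun i => B (s + i) (a i))

theorem pairSum_zero (N c : ℕ) (A : ℕ → V) (B : ℕ → W)
    (φ : V [⋀^Fin 0]→ₗ[R] R) (ψ : W [⋀^Fin 0]→ₗ[R] R) :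
    pairSum N 0 c A B φ ψ = φ ![] * ψ ![] := by
  rw [pairSum, incSeq_zero, Finset.sum_singleton]
  congr 2 <;> exact Subsingleton.elim _ _

theorem flagSum_zero (N s c : ℕ) (A : ℕ → ℕ → V) (B : ℕ → ℕ → W)
    (φ : V [⋀^Fin 0]→ₗ[R] R) (ψ : W [⋀^Fin 0]→ₗ[R] R) :
    flagSum N 0 s c A B φ ψ = φ ![] * ψ ![] := by
  rw [flagSum, incSeq_zero, Finset.sum_singleton]
  congr 2 <;> exact Subsingleton.elim _ _

theorem pairSum_succ (N k c : ℕ) (A : ℕ → V) (B : ℕ → W)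
    (φ : V [⋀^Fin (k + 1)]→ₗ[R] R) (ψ : W [⋀^Fin (k + 1)]→ₗ[R] R) :
    pairSum N (k + 1) c A B φ ψ = ∑ b ∈ Finset.Ico c N,
      pairSum N k (b + 1) A B (φ.curryLeft (A b)) (ψ.curryLeft (B b)) := by
  simp only [pairSum, sum_incSeq_succ, vecCons_comp, AlternatingMap.curryLeft_apply_apply]

theorem flagSum_succ (N k s c : ℕ) (A : ℕ → ℕ → V) (B : ℕ → ℕ → W)
    (φ : V [⋀^Fin (k + 1)]→ₗ[R] R) (ψ : W [⋀^Fin (k + 1)]→ₗ[R] R) :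
    flagSum N (k + 1) s c A B φ ψ = ∑ b ∈ Finset.Ico c N,
      flagSum N k (s + 1) (b + 1) A B (φ.curryLeft (A s b)) (ψ.curryLeft (B s b)) := by
  simp only [flagSum, sum_incSeq_succ, vecCons_comp_level, AlternatingMap.curryLeft_apply_apply]

theorem pairSum_linear_left (N k c : ℕ) (A : ℕ → V) (B : ℕ → W)
    (φ φ' : V [⋀^Fin k]→ₗ[R] R) (ψ : W [⋀^Fin k]→ₗ[R] R) (r : R) :
    pairSum N k c A B (φ + r • φ') ψ = pairSum N k c A B φ ψ + r * pairSum N k c A B φ' ψ := by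
  simp only [pairSum, Finset.mul_sum, ← Finset.sum_add_distrib]
  refine Finset.sum_congr rfl fun a _ => ?_
  simp only [AlternatingMap.add_apply, AlternatingMap.smul_apply, smul_eq_mul]
  ring

theorem pairSum_linear_right (N k c : ℕ) (A : ℕ → V) (B : ℕ → W)
    (φ : V [⋀^Fin k]→ₗ[R] R) (ψ ψ' : W [⋀^Fin k]→ₗ[R] R) (r : R) :
    pairSum N k c A B φ (ψ + r • ψ') = pairSum N k c A B φ ψ + r * pairSum N k c A B φ ψ' := by
  simp only [pairSum, Finset.mul_sum, ← Finset.sum_add_distrib]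
  refine Finset.sum_congr rfl fun a _ => ?_
  simp only [AlternatingMap.add_apply, AlternatingMap.smul_apply, smul_eq_mul]
  ring

theorem pairSum_zero_left (N k c : ℕ) (A : ℕ → V) (B : ℕ → W) (ψ : W [⋀^Fin k]→ₗ[R] R) :
    pairSum N k c A B 0 ψ = 0 := by
  simp [pairSum]

theorem pairSum_zero_right (N k c : ℕ) (A : ℕ → V) (B : ℕ → W) (φ : V [⋀^Fin k]→ₗ[R] R) :
    pairSum N k c A B φ 0 = 0 := by
  simp [pairSum]

/-- Raising the lower bound past `c` does nothing if the left form already contains `A c`. -/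
theorem pairSum_lower_bound (N k c : ℕ) (A : ℕ → V) (B : ℕ → W)
    (φ : V [⋀^Fin (k + 1)]→ₗ[R] R) (ψ : W [⋀^Fin k]→ₗ[R] R) :
    pairSum N k c A B (φ.curryLeft (A c)) ψ = pairSum N k (c + 1) A B (φ.curryLeft (A c)) ψ := by
  cases k with
  | zero => rw [pairSum_zero, pairSum_zero]
  | succ k =>
    rw [pairSum_succ, pairSum_succ]
    rcases lt_or_ge c N with h | h
    · rw [Finset.sum_eq_sum_Ico_succ_bot h, AlternatingMap.curryLeft_same, pairSum_zero_left,
        zero_add]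
    · rw [Finset.Ico_eq_empty (by omega), Finset.Ico_eq_empty (by omega)]

theorem pairSum_change_of_family (N : ℕ) (A A' : ℕ → V) (B B' : ℕ → W) (τ : R)
    (hA : ∀ a, A' a = A a + τ • A' (a + 1)) (hN : A' N = 0)
    (hB0 : B 0 = B' 0) (hB : ∀ a, B (a + 1) = B' (a + 1) + τ • B a) (k c : ℕ) (hc : c ≤ N)
    (φ : V [⋀^Fin k]→ₗ[R] R) (ψ : W [⋀^Fin k]→ₗ[R] R)
    (hψ : ∀ d, c = d + 1 → ∀ w : Fin k → W, (∃ i, w i = B d) → ψ w = 0) :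
    pairSum N k c A B φ ψ = pairSum N k c A' B' φ ψ := by
  induction k generalizing c with
  | zero => rw [pairSum_zero, pairSum_zero]
  | succ k ih =>
    rw [pairSum_succ, pairSum_succ]
    set E : ℕ → R := fun a => pairSum N k (a + 1) A' B' (φ.curryLeft (A' a))
      (ψ.curryLeft (if a = 0 then 0 else B (a - 1))) with hE
    have key : ∀ b ∈ Finset.Ico c N,
        pairSum N k (b + 1) A B (φ.curryLeft (A b)) (ψ.curryLeft (B b)) =
          pairSum N k (b + 1) A' B' (φ.curryLeft (A' b)) (ψ.curryLeft (B' b)) -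
            τ * (E (b + 1) - E b) := by
      intro b hb
      rw [Finset.mem_Ico] at hb
      rw [ih (b + 1) (by omega)]
      · have h1 : A b = A' b + (-τ) • A' (b + 1) := by rw [hA b]; module
        have h2 : B b = B' b + τ • (if b = 0 then 0 else B (b - 1)) := by
          cases b with
          | zero => simp [hB0]
          | succ b => simpa using hB b
        have h3 : E (b + 1) =
            pairSum N k (b + 1) A' B' (φ.curryLeft (A' (b + 1))) (ψ.curryLeft (B b)) := by
          simp [hE, ← pairSum_lower_bound]
        have h4 : pairSum N k (b + 1) A' B' (φ.curryLeft (A' b)) (ψ.curryLeft (B b)) =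
            pairSum N k (b + 1) A' B' (φ.curryLeft (A' b)) (ψ.curryLeft (B' b)) + τ * E b := by
          rw [hE, ← pairSum_linear_right, ← map_smul, ← map_add, ← h2]
        calc _ = pairSum N k (b + 1) A' B' (φ.curryLeft (A' b + (-τ) • A' (b + 1)))
                  (ψ.curryLeft (B b)) := by rw [← h1]
          _ = _ := by
            rw [map_add, map_smul, pairSum_linear_left, ← h3, h4]
            ring
      · rintro d hd w ⟨i, hi⟩
        rw [AlternatingMap.curryLeft_apply_apply]
        refine ψ.map_eq_zero_of_eq _ (i := 0) (j := i.succ) ?_ (Fin.succ_ne_zero i).symm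
        simp only [Matrix.cons_val_zero, Matrix.cons_val_succ, hi]
        congr 1
        omega
    rw [Finset.sum_congr rfl key, Finset.sum_sub_distrib, ← Finset.mul_sum,
      Finset.sum_Ico_sub E hc]
    have hEN : E N = 0 := by simp [hE, hN, pairSum_zero_left]
    have hEc : E c = 0 := by
      have : ψ.curryLeft (if c = 0 then 0 else B (c - 1)) = 0 := by
        split_ifs with h
        · simp
        · ext w
          exact hψ (c - 1) (by omega) _ ⟨0, by simp⟩
      simp [hE, this, pairSum_zero_right]
    rw [hEN, hEc]
    ring

theorem flagSum_eq_pairSum (N : ℕ) (A : ℕ → ℕ → V) (B : ℕ → ℕ → W) (τ : ℕ → R) (K : ℕ)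
    (hA : ∀ s, s + 1 < K → ∀ a, A (s + 1) a = A s a + τ s • A (s + 1) (a + 1))
    (hN : ∀ s, A s N = 0)
    (hB0 : ∀ s, s + 1 < K → B s 0 = B (s + 1) 0)
    (hB : ∀ s, s + 1 < K → ∀ a, B s (a + 1) = B (s + 1) (a + 1) + τ s • B s a)
    (k s c : ℕ) (hk : s + k ≤ K)
    (φ : V [⋀^Fin k]→ₗ[R] R) (ψ : W [⋀^Fin k]→ₗ[R] R) :
    flagSum N k s c A B φ ψ = pairSum N k c (A s) (B s) φ ψ := by
  induction k generalizing s c with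
  | zero => rw [flagSum_zero, pairSum_zero]
  | succ k ih =>
    rw [flagSum_succ, pairSum_succ]
    refine Finset.sum_congr rfl fun b hb => ?_
    rw [Finset.mem_Ico] at hb
    rw [ih (s + 1) (b + 1) (by omega)]
    rcases Nat.eq_zero_or_pos k with rfl | hk0
    · rw [pairSum_zero, pairSum_zero]
    symm
    have hs : s + 1 < K := by omega
    refine pairSum_change_of_family N _ _ _ _ (τ s) (hA s hs) (hN _) (hB0 s hs) (hB s hs) k _
      (by omega) _ _ ?_
    rintro d hd w ⟨i, hi⟩
    rw [AlternatingMap.curryLeft_apply_apply]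
    refine ψ.map_eq_zero_of_eq _ (i := 0) (j := i.succ) ?_ (Fin.succ_ne_zero i).symm
    simp only [Matrix.cons_val_zero, Matrix.cons_val_succ, hi]
    congr 1
    omega

theorem sum_curryLeft_apply {ι : Type*} {k : ℕ} (S : Finset ι) (u : ι → V)
    (ψ : V [⋀^Fin (k + 1)]→ₗ[R] R) (w : Fin k → V) :
    ∑ b ∈ S, ψ.curryLeft (u b) w = ψ (Matrix.vecCons (∑ b ∈ S, u b) w) := by
  rw [← AlternatingMap.curryLeft_apply_apply]
  induction S using Finset.induction_on with
  | empty => simp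
  | insert b S hb ih =>
    rw [Finset.sum_insert hb, Finset.sum_insert hb, map_add, AlternatingMap.add_apply, ih]

/-- If every partial sum of `v (s + 1)` is proportional to a vector of the family `v s`, the
constraint that the sequence be strictly increasing can be dropped. -/
theorem sum_incSeq_alternating (N : ℕ) (v : ℕ → ℕ → V) (K : ℕ)
    (hv : ∀ s, s + 1 < K → ∀ b < N, ∃ (u : V) (d e : R),
      v s b = d • u ∧ ∑ a ∈ Finset.range (b + 1), v (s + 1) a = e • u)
    (k s c : ℕ) (hk : s + k ≤ K) (hc : c ≤ N) (ψ : V [⋀^Fin k]→ₗ[R] R)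
    (hψ : ∀ w : Fin k → V, (∃ i, w i = ∑ a ∈ Finset.range c, v s a) → ψ w = 0) :
    ∑ a ∈ incSeq N k c, ψ (fun i => v (s + i) (a i)) =
      ψ (fun i => ∑ a ∈ Finset.range N, v (s + i) a) := by
  induction k generalizing s c with
  | zero =>
    rw [incSeq_zero, Finset.sum_singleton]
    exact congrArg ψ (Subsingleton.elim _ _)
  | succ k ih =>
    rw [sum_incSeq_succ]
    set w : Fin k → V := fun i => ∑ a ∈ Finset.range N, v (s + 1 + i) a with hw
    have h1 : ∀ b ∈ Finset.Ico c N,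
        ∑ q ∈ incSeq N k (b + 1), ψ (fun i => v (s + i) (Matrix.vecCons b q i)) =
          ψ.curryLeft (v s b) w := by
      intro b hb
      rw [Finset.mem_Ico] at hb
      rw [hw, ← ih (s + 1) (b + 1) (by omega) (by omega)]
      · simp only [vecCons_comp_level, AlternatingMap.curryLeft_apply_apply]
      · rintro y ⟨i, hi⟩
        obtain ⟨u, d, e, h1, h2⟩ := hv s (by have := i.2; omega) b hb.2
        have hy : y = Function.update y i (e • u) := by
          rw [← h2, ← hi, Function.update_eq_self]
        rw [hy, AlternatingMap.map_update_smul, h1, map_smul, AlternatingMap.smul_apply,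
          AlternatingMap.curryLeft_apply_apply]
        rw [ψ.map_eq_zero_of_eq (i := 0) (j := i.succ) _ (by simp) (Fin.succ_ne_zero i).symm]
        simp
    rw [Finset.sum_congr rfl h1]
    have h2 : (∑ b ∈ Finset.range c, ψ.curryLeft (v s b) w) = 0 := by
      rw [sum_curryLeft_apply]
      exact hψ _ ⟨0, by simp⟩
    have h3 := Finset.sum_range_add_sum_Ico (fun b => ψ.curryLeft (v s b) w) hc
    rw [h2, zero_add] at h3
    rw [h3, sum_curryLeft_apply]
    congr 1
    funext i
    induction i using Fin.cases with
    | zero => simp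
    | succ i => simp [hw, add_assoc, add_comm 1]

end Flags

section Series

open PowerSeries

/-- The geometric series `1 / (1 - a X)`. -/
def geomSeries (a : R) : PowerSeries R := PowerSeries.mk fun n => a ^ n

theorem coeff_succ_mul_geomSeries (P : PowerSeries R) (a : R) (n : ℕ) :
    coeff (n + 1) (P * geomSeries a) = coeff (n + 1) P + a * coeff n (P * geomSeries a) := by
  have h : geomSeries a = 1 + X * (C a * geomSeries a) := by
    ext n
    cases n with
    | zero => simp [geomSeries]
    | succ n => simp [geomSeries, coeff_succ_X_mul, coeff_one, pow_succ']
  have h2 : P * geomSeries a = P + X * (C a * (P * geomSeries a)) := by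
    conv_lhs => rw [h]
    ring
  conv_lhs => rw [h2, map_add, coeff_succ_X_mul, coeff_C_mul]

theorem coeff_zero_mul_geomSeries (P : PowerSeries R) (a : R) :
    coeff 0 (P * geomSeries a) = coeff 0 P := by
  simp [geomSeries]

/-- The generating series of the complete homogeneous symmetric functions of a list. -/
def hSeries (L : List R) : PowerSeries R := (L.map geomSeries).prod

/-- The vector of coefficients of `P` in degrees `a, a - 1, …, a - (k - 1)`. -/
def coeffRow (k : ℕ) (P : PowerSeries R) (a : ℕ) : Fin k → R := fun i => coeff a (X ^ (i : ℕ) * P)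

theorem coeffRow_succ (k : ℕ) (P : PowerSeries R) (y : R) (a : ℕ) :
    coeffRow k (P * geomSeries y) (a + 1) =
      coeffRow k P (a + 1) + y • coeffRow k (P * geomSeries y) a := by
  funext i
  simp only [coeffRow, ← mul_assoc, Pi.add_apply, Pi.smul_apply, smul_eq_mul]
  exact coeff_succ_mul_geomSeries _ _ _

theorem coeffRow_zero (k : ℕ) (P : PowerSeries R) (y : R) :
    coeffRow k (P * geomSeries y) 0 = coeffRow k P 0 := by
  funext i
  simp only [coeffRow, ← mul_assoc]
  exact coeff_zero_mul_geomSeries _ _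

section TwoRows

variable {V : Type*} [AddCommGroup V] [Module R V]

theorem partial_sum_weight (H H' : ℕ → V) (τ : R) (w : ℕ → R) (M : ℕ)
    (h0 : H 0 = H' 0) (hH : ∀ a, H (a + 1) = H' (a + 1) + τ • H a)
    (hw : ∀ a ≤ M, w a = τ * w (a + 1)) (b : ℕ) (hb : b ≤ M) :
    ∑ a ∈ Finset.range (b + 1), w a • H' a =
      w b • H b := by
  induction b with
  | zero => simp [h0]
  | succ b ih =>
    rw [Finset.sum_range_succ, ih (by omega), hH b, hw b (by omega)]
    module

theorem full_sum_weight (H H' F F' : ℕ → V) (τ y : R) (w : ℕ → R) (M D : ℕ)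
    (h0 : H 0 = H' 0) (hH : ∀ a, H (a + 1) = H' (a + 1) + τ • H a)
    (hF0 : F 0 = H 0) (hF : ∀ a, F (a + 1) = H (a + 1) + y • F a)
    (hF0' : F' 0 = H' 0) (hF' : ∀ a, F' (a + 1) = H' (a + 1) + y • F' a)
    (hw : ∀ a ≤ M, w a = τ * w (a + 1))
    (hwy : ∀ a, M < a → a < M + 1 + D → w a = y * w (a + 1)) (hw1 : w (M + 1 + D) = 1) :
    F' (M + 1 + D) = ∑ a ∈ Finset.range (M + 1 + D + 1), w a • H' a +
      (y ^ D * (y - τ)) • F M := by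
  have hFF0 : F 0 = F' 0 := by rw [hF0, hF0', h0]
  have hFF : ∀ a, F (a + 1) = F' (a + 1) + τ • F a := by
    intro a
    induction a with
    | zero => rw [hF, hF', hH, hF0, hF0', h0]; module
    | succ a ih =>
      rw [hF, hF', hH (a + 1)]
      have e : H (a + 1) = F (a + 1) - y • F a := by rw [hF]; module
      rw [e]
      have e2 : y • F' (a + 1) = y • F (a + 1) - (y * τ) • F a := by rw [ih]; module
      rw [e2]
      module
  have hyF : y • F' M = τ • H M + (y - τ) • F M := by
    cases M with
    | zero => rw [← hFF0, hF0]; module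
    | succ a =>
      have e : F' (a + 1) = F (a + 1) - τ • F a := by rw [hFF]; module
      have e2 : H (a + 1) = F (a + 1) - y • F a := by rw [hF]; module
      rw [e, e2]
      module
  have hwD : ∀ e ≤ D, w (M + 1 + D - e) = y ^ e := by
    intro e he
    induction e with
    | zero => simpa using hw1
    | succ e ih =>
      rw [hwy _ (by omega) (by omega), pow_succ', ← ih (by omega)]
      congr 2
      omega
  have key : ∀ e ≤ D, w (M + 1 + e) • F' (M + 1 + e) =
      ∑ a ∈ Finset.range (M + 1 + e + 1), w a • H' a + (y ^ D * (y - τ)) • F M := by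
    intro e he
    induction e with
    | zero =>
      have hp := partial_sum_weight H H' τ w M h0 hH hw M le_rfl
      have hD : y ^ D = w (M + 1) := by rw [← hwD D le_rfl]; congr 1; omega
      rw [add_zero, Finset.sum_range_succ, hp, hF', hw M le_rfl, hD, smul_add, smul_smul,
        mul_comm _ y, mul_comm y, ← smul_smul, hyF]
      module
    | succ e ih =>
      rw [← add_assoc, Finset.sum_range_succ]
      have h1 := ih (by omega)
      rw [hwy _ (by omega) (by omega)] at h1
      rw [hF', smul_add, add_right_comm (∑ a ∈ Finset.range (M + 1 + e + 1), w a • H' a), ← h1]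
      module
  have := key D le_rfl
  rwa [hw1, one_smul] at this

end TwoRows

/-- The weight of a horizontal strip in row `s` (counted from the bottom) of a single-variable
skew refined dual Grothendieck polynomial; `L` records the shifted row lengths of the outer shape
and `a` that of the inner one. -/
def stripWeight (L : ℕ → ℕ) (τ : ℕ → R) (y : R) (s a : ℕ) : R :=
  if a ≤ L s then
    ∏ c ∈ Finset.Ico a (L s), if 0 < s ∧ c ≤ L (s - 1) then τ (s - 1) else y
  else 0

theorem stripWeight_self (L : ℕ → ℕ) (τ : ℕ → R) (y : R) (s : ℕ) :
    stripWeight L τ y s (L s) = 1 := by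
  simp [stripWeight]

theorem stripWeight_of_lt (L : ℕ → ℕ) (τ : ℕ → R) (y : R) (s a : ℕ) (h : a < L s) :
    stripWeight L τ y s a =
      (if 0 < s ∧ a ≤ L (s - 1) then τ (s - 1) else y) * stripWeight L τ y s (a + 1) := by
  rw [stripWeight, stripWeight, if_pos h.le, if_pos (Nat.succ_le_of_lt h), Finset.prod_eq_prod_Ico_succ_bot h]

theorem det_mul_geomSeries_eq_sum (ℓ N : ℕ) (P : ℕ → PowerSeries R) (τ : ℕ → R) (y : R)
    (hP : ∀ s, s + 1 < ℓ → P s = P (s + 1) * geomSeries (τ s))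
    (L : ℕ → ℕ) (hL : ∀ s, s + 1 < ℓ → L s < L (s + 1)) (hLN : ∀ s < ℓ, L s < N) :
    Matrix.det (Matrix.of fun i : Fin ℓ => coeffRow ℓ (P i * geomSeries y) (L i)) =
      ∑ a ∈ incSeq N ℓ 0, (∏ i : Fin ℓ, stripWeight L τ y i (a i)) *
        Matrix.det (Matrix.of fun i : Fin ℓ => coeffRow ℓ (P i) (a i)) := by
  cases ℓ with
  | zero =>
    rw [incSeq_zero]
    simp
  | succ m =>
  set ℓ := m + 1 with hℓ
  set w := stripWeight L τ y with hw
  set v : ℕ → ℕ → Fin ℓ → R := fun s a => w s a • coeffRow ℓ (P s) a with hv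
  have hsum : ∀ s < ℓ, ∑ a ∈ Finset.range N, v s a = ∑ a ∈ Finset.range (L s + 1), v s a := by
    intro s hs
    symm
    refine Finset.sum_subset (Finset.range_mono (hLN s hs)) fun a _ ha => ?_
    rw [Finset.mem_range] at ha
    simp only [hv, hw, stripWeight]
    rw [if_neg (by omega), zero_smul]
  have hH : ∀ s, s + 1 < ℓ → ∀ a, coeffRow ℓ (P s) (a + 1) =
      coeffRow ℓ (P (s + 1)) (a + 1) + τ s • coeffRow ℓ (P s) a := by
    intro s hs a
    rw [hP s hs, coeffRow_succ]
  have hH0 : ∀ s, s + 1 < ℓ → coeffRow ℓ (P s) 0 = coeffRow ℓ (P (s + 1)) 0 := by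
    intro s hs
    rw [hP s hs, coeffRow_zero]
  have hwτ : ∀ s, s + 1 < ℓ → ∀ a ≤ L s, w (s + 1) a = τ s * w (s + 1) (a + 1) := by
    intro s hs a ha
    have := hL s hs
    rw [hw, stripWeight_of_lt L τ y (s + 1) a (by omega), if_pos ⟨by omega, by simpa using ha⟩]
    rfl
  have hwy : ∀ s, s + 1 < ℓ → ∀ a, L s < a → a < L (s + 1) →
      w (s + 1) a = y * w (s + 1) (a + 1) := by
    intro s hs a ha ha'
    rw [hw, stripWeight_of_lt L τ y (s + 1) a ha', if_neg]
    rintro ⟨_, h⟩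
    simp only [Nat.add_sub_cancel] at h
    omega
  have h1 : ∑ a ∈ incSeq N ℓ 0, (∏ i : Fin ℓ, w i (a i)) *
        Matrix.det (Matrix.of fun i : Fin ℓ => coeffRow ℓ (P i) (a i)) =
      ∑ a ∈ incSeq N ℓ 0, Matrix.detRowAlternating (fun i : Fin ℓ => v (0 + i) (a i)) := by
    refine Finset.sum_congr rfl fun a _ => ?_
    have := (Matrix.detRowAlternating (n := Fin ℓ) (R := R)).toMultilinearMap.map_smul_univ
      (fun i => w i (a i)) (fun i => coeffRow ℓ (P i) (a i))
    simp only [zero_add]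
    exact this.symm
  rw [h1, sum_incSeq_alternating N v ℓ ?_ ℓ 0 0 (by omega) (Nat.zero_le _)]
  · have h2 : Matrix.detRowAlternating (fun i : Fin ℓ => ∑ a ∈ Finset.range N, v (0 + i) a) =
        Matrix.det (Matrix.of fun i : Fin ℓ => ∑ a ∈ Finset.range (L i + 1), v i a) := by
      change Matrix.det _ = _
      congr 1
      funext i
      rw [zero_add, hsum i i.2]
      rfl
    rw [h2]
    refine Matrix.det_eq_of_forall_row_eq_smul_add_pred
      (fun i : Fin m => y ^ (L (i + 1) - L i - 1) * (y - τ i)) ?_ ?_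
    · intro j
      have h3 : ∀ b, b ≤ L 0 → ∑ a ∈ Finset.range (b + 1), v 0 a =
          w 0 b • coeffRow ℓ (P 0 * geomSeries y) b := by
        intro b hb
        induction b with
        | zero => simp [hv, coeffRow_zero]
        | succ b ih =>
          rw [Finset.sum_range_succ, ih (by omega), hw,
            stripWeight_of_lt L τ y 0 b (by omega), if_neg (by simp), coeffRow_succ]
          simp only [hv, hw]
          module
      have h4 := h3 (L 0) le_rfl
      rw [hw, stripWeight_self, one_smul] at h4
      exact (congrFun h4 j).symm
    · intro i j
      have hi : (i : ℕ) + 1 < ℓ := by omega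
      have hlt := hL i hi
      have h5 := full_sum_weight (coeffRow ℓ (P i)) (coeffRow ℓ (P (i + 1)))
        (coeffRow ℓ (P i * geomSeries y)) (coeffRow ℓ (P (i + 1) * geomSeries y)) (τ i) y
        (w (i + 1)) (L i) (L (i + 1) - L i - 1) (hH0 i hi) (hH i hi)
        (coeffRow_zero _ _ _) (coeffRow_succ _ _ _) (coeffRow_zero _ _ _) (coeffRow_succ _ _ _)
        (hwτ i hi)
      have e : L i + 1 + (L (i + 1) - L i - 1) = L (i + 1) := by omega
      rw [e] at h5
      exact congrFun (h5 (hwy i hi) (stripWeight_self _ _ _ _)) j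
  · rintro u ⟨i, hi⟩
    exact AlternatingMap.map_coord_zero _ i (by simpa using hi)
  · intro s hs b _
    rcases le_or_gt b (L s) with hb | hb
    · refine ⟨coeffRow ℓ (P s) b, w s b, w (s + 1) b, rfl, ?_⟩
      have := partial_sum_weight (coeffRow ℓ (P s)) (coeffRow ℓ (P (s + 1))) (τ s) (w (s + 1)) (L s)
        (hH0 s hs) (hH s hs) (hwτ s hs) b hb
      exact this
    · refine ⟨∑ a ∈ Finset.range (b + 1), v (s + 1) a, 0, 1, ?_, (one_smul _ _).symm⟩
      simp only [hv, hw, stripWeight]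
      rw [if_neg (by omega), zero_smul, zero_smul]

end Series

section Sequences

theorem StrictMono.add_sub_le {ℓ : ℕ} {a : Fin ℓ → ℕ} (ha : StrictMono a) {i j : Fin ℓ}
    (hij : i ≤ j) : a i + ((j : ℕ) - i) ≤ a j := by
  obtain ⟨j, hj⟩ := j
  induction j with
  | zero =>
    have : i = ⟨0, hj⟩ := le_antisymm hij (Nat.zero_le _)
    simp [this]
  | succ j ih =>
    rcases hij.eq_or_lt with h | h
    · simp [h]
    · have hle : i ≤ ⟨j, by omega⟩ := Nat.lt_succ_iff.1 h
      have h1 := ih (by omega) hle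
      have h2 : a ⟨j, by omega⟩ < a ⟨j + 1, hj⟩ := ha (Nat.lt_succ_self j)
      have h3 : (i : ℕ) ≤ j := hle
      simp only at h1 ⊢
      omega

theorem StrictMono.le_apply_fin {ℓ : ℕ} {a : Fin ℓ → ℕ} (ha : StrictMono a) (i : Fin ℓ) :
    (i : ℕ) ≤ a i := by
  have hi := i.2
  have h : (⟨0, by omega⟩ : Fin ℓ) ≤ i := Nat.zero_le _
  have := ha.add_sub_le h
  simp only [Nat.sub_zero] at this
  omega

/-- Partitions contained in `nu` correspond to increasing sequences by adding a staircase to the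
parts read from the bottom. -/
theorem sum_partitions_eq_sum_incSeq (ℓ N : ℕ) (nu : ℕ → ℕ) (f : (Fin ℓ → ℕ) → R)
    (hN : ∀ i : Fin ℓ, nu (Fin.rev i) + i < N)
    (hf : ∀ a ∈ incSeq N ℓ 0, f a ≠ 0 → ∀ i : Fin ℓ, a i ≤ nu (Fin.rev i) + i) :
    ∑ p ∈ Finset.univ.filter (fun p : (i : Fin ℓ) → Fin (nu i.1 + 1) =>
        ∀ i j : Fin ℓ, (i : ℕ) ≤ (j : ℕ) → (p j : ℕ) ≤ (p i : ℕ)),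
      f (fun i => (p (Fin.rev i) : ℕ) + i) = ∑ a ∈ incSeq N ℓ 0, f a := by
  rw [← Finset.sum_filter_of_ne hf]
  refine Finset.sum_nbij (fun p => fun i => (p (Fin.rev i) : ℕ) + i) ?_ ?_ ?_ fun _ _ => rfl
  · intro p hp
    simp only [Finset.mem_filter, Finset.mem_univ, true_and] at hp
    simp only [Finset.mem_filter, mem_incSeq]
    have h1 : ∀ i : Fin ℓ, (p (Fin.rev i) : ℕ) ≤ nu (Fin.rev i) :=
      fun i => Nat.lt_succ_iff.1 (p (Fin.rev i)).2
    refine ⟨⟨fun i => ⟨Nat.zero_le _, ?_⟩, fun i j hij => ?_⟩, fun i => ?_⟩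
    · have := h1 i
      have := hN i
      omega
    · have h2 := hp (Fin.rev j) (Fin.rev i) (Fin.rev_le_rev.2 hij.le)
      have h3 : (i : ℕ) < j := hij
      change (p (Fin.rev i) : ℕ) + i < (p (Fin.rev j) : ℕ) + j
      omega
    · have := h1 i
      omega
  · intro p _ q _ hpq
    funext i
    have := congrFun hpq (Fin.rev i)
    simp only [Nat.add_right_cancel_iff] at this
    rw [Fin.rev_rev] at this
    exact Fin.ext this
  · intro a ha
    simp only [Finset.coe_filter, mem_incSeq, Set.mem_ofPred_eq] at ha
    obtain ⟨⟨_, hm⟩, hle⟩ := ha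
    have hb : ∀ i : Fin ℓ, a (Fin.rev i) - (Fin.rev i : ℕ) < nu i + 1 := by
      intro i
      have := hle (Fin.rev i)
      rw [Fin.rev_rev] at this
      omega
    refine ⟨fun i => ⟨a (Fin.rev i) - (Fin.rev i : ℕ), hb i⟩, ?_, ?_⟩
    · simp only [Finset.coe_filter, Finset.mem_univ, true_and, Set.mem_ofPred_eq]
      intro i j hij
      have h1 : Fin.rev j ≤ Fin.rev i := Fin.rev_le_rev.2 hij
      have h2 := hm.add_sub_le h1
      have h3 : ((Fin.rev j : Fin ℓ) : ℕ) ≤ (Fin.rev i : Fin ℓ) := h1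
      have h4 := hm.le_apply_fin (Fin.rev j)
      omega
    · funext i
      have := hm.le_apply_fin i
      simp only [Fin.rev_rev]
      omega

end Sequences

section Branching

theorem prod_fin_split {m M : ℕ} (h : m ≤ M) (g : Fin M → R) (g' : Fin m → R) (w : ℕ → R)
    (h1 : ∀ c : Fin m, g (Fin.castLE h c) = g' c)
    (h2 : ∀ c : Fin M, m ≤ (c : ℕ) → g c = w c) :
    ∏ c, g c = (∏ c ∈ Finset.Ico m M, w c) * ∏ c, g' c := by
  obtain ⟨d, rfl⟩ := Nat.exists_eq_add_of_le h
  rw [Fin.prod_univ_add, mul_comm, Finset.prod_Ico_eq_prod_range, Finset.prod_range]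
  congr 1
  · have e : m + d - m = d := by omega
    rw [← Fin.prod_congr' (fun i : Fin (m + d - m) => w (m + i)) e.symm]
    refine Finset.prod_congr rfl fun c _ => ?_
    rw [h2 _ (by simp)]
    simp
  · exact Finset.prod_congr rfl fun c _ => h1 c

theorem lt_card_filter_iff {m n : ℕ} (f : Fin m → ℕ) (hf : Monotone f) (c : Fin m) :
    (c : ℕ) < (Finset.univ.filter fun d => f d ≤ n).card ↔ f c ≤ n := by
  constructor
  · intro h
    by_contra hc
    have hsub : (Finset.univ.filter fun d => f d ≤ n) ⊆ Finset.Iio c := by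
      intro d hd
      simp only [Finset.mem_filter, Finset.mem_univ, true_and] at hd
      rw [Finset.mem_Iio]
      by_contra hdc
      have := hf (not_lt.1 hdc)
      omega
    have := Finset.card_le_card hsub
    rw [Fin.card_Iio] at this
    omega
  · intro h
    have hsub : Finset.Iic c ⊆ Finset.univ.filter fun d => f d ≤ n := by
      intro d hd
      simp only [Finset.mem_filter, Finset.mem_univ, true_and]
      exact (hf (Finset.mem_Iic.1 hd)).trans h
    have := Finset.card_le_card hsub
    rw [Fin.card_Iic] at this
    omega

/-- Extend a filling of `mu` to one of `lam` by the largest entry. -/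
def glueFilling (ℓ n : ℕ) (lam mu : ℕ → ℕ) (T : YBox ℓ mu → Fin (n + 1)) :
    YBox ℓ lam → Fin (n + 2) :=
  fun b => if h : (b.2 : ℕ) < mu b.1.1 then (T ⟨b.1, ⟨b.2, h⟩⟩).castSucc else Fin.last (n + 1)

/-- Restrict a filling of `lam` to `mu`, where the largest entry should not occur. -/
def restrictFilling (ℓ n : ℕ) (lam mu : ℕ → ℕ) (h : ∀ r : Fin ℓ, mu r ≤ lam r)
    (T : YBox ℓ lam → Fin (n + 2)) : YBox ℓ mu → Fin (n + 1) :=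
  fun b => if hb : (T ⟨b.1, Fin.castLE (h b.1) b.2⟩ : ℕ) < n + 1 then ⟨_, hb⟩ else 0

/-- The weight of the boxes of `lam / mu` when all of them carry the entry with variable `y`. -/
def skewWeight (ℓ : ℕ) (lam mu : ℕ → ℕ) (y : R) (t : ℕ → R) : R :=
  ∏ r : Fin ℓ, ∏ c ∈ Finset.Ico (mu r) (lam r),
    if (r : ℕ) + 1 < ℓ ∧ c < lam (r + 1) then t (r + 1) else y

/-- Reverse plane partitions of shape `lam` whose boxes with entry at most `n` form `mu`. -/
def fiberRPP (ℓ n : ℕ) (lam mu : ℕ → ℕ) : Finset (YBox ℓ lam → Fin (n + 2)) :=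
  Finset.univ.filter fun T => IsSkewRPP ℓ (n + 1) lam (fun _ => 0) T ∧
    ∀ b : YBox ℓ lam, (T b : ℕ) ≤ n ↔ (b.2 : ℕ) < mu b.1.1

variable {ℓ n : ℕ} {lam mu : ℕ → ℕ}

theorem restrictFilling_val (h : ∀ r : Fin ℓ, mu r ≤ lam r) {T : YBox ℓ lam → Fin (n + 2)}
    (hT : T ∈ fiberRPP ℓ n lam mu) (b : YBox ℓ mu) :
    (restrictFilling ℓ n lam mu h T b : ℕ) = T ⟨b.1, Fin.castLE (h b.1) b.2⟩ := by
  simp only [fiberRPP, Finset.mem_filter, Finset.mem_univ, true_and] at hT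
  have := (hT.2 ⟨b.1, Fin.castLE (h b.1) b.2⟩).2 b.2.2
  rw [restrictFilling, dif_pos (by omega)]

theorem restrictFilling_isSkewRPP (h : ∀ r : Fin ℓ, mu r ≤ lam r) {T : YBox ℓ lam → Fin (n + 2)}
    (hT : T ∈ fiberRPP ℓ n lam mu) :
    IsSkewRPP ℓ n mu (fun _ => 0) (restrictFilling ℓ n lam mu h T) := by
  have hv := restrictFilling_val h hT
  simp only [fiberRPP, Finset.mem_filter, Finset.mem_univ, true_and] at hT
  obtain ⟨⟨h1, h2, h3⟩, -⟩ := hT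
  refine ⟨fun b => ?_, fun r c c' _ hc => ?_, fun r r' c c' hr hc _ _ => ?_⟩
  · rw [hv, h1]
    simp
  · rw [Fin.le_def, hv, hv]
    exact h2 r _ _ (Nat.zero_le _) hc
  · rw [Fin.le_def, hv, hv]
    exact h3 r r' _ _ hr hc (Nat.zero_le _) (Nat.zero_le _)

theorem glueFilling_mem (hmu : ∀ a b : ℕ, a ≤ b → b < ℓ → mu b ≤ mu a)
    {T : YBox ℓ mu → Fin (n + 1)} (hT : IsSkewRPP ℓ n mu (fun _ => 0) T) :
    glueFilling ℓ n lam mu T ∈ fiberRPP ℓ n lam mu := by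
  obtain ⟨h1, h2, h3⟩ := hT
  simp only [fiberRPP, Finset.mem_filter, Finset.mem_univ, true_and]
  refine ⟨⟨fun b => ?_, fun r c c' _ hc => ?_, fun r r' c c' hr hc _ _ => ?_⟩, fun b => ?_⟩
  · simp only [glueFilling]
    split_ifs with hb
    · simpa using h1 ⟨b.1, ⟨b.2, hb⟩⟩
    · simp
  · simp only [glueFilling]
    by_cases hb' : (c' : ℕ) < mu r
    · have hb : (c : ℕ) < mu r := lt_of_le_of_lt hc hb'
      rw [dif_pos hb, dif_pos hb']
      exact h2 r ⟨c, hb⟩ ⟨c', hb'⟩ (Nat.zero_le _) hc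
    · rw [dif_neg hb']
      exact Fin.le_last _
  · simp only [glueFilling]
    by_cases hb' : (c' : ℕ) < mu r'
    · have hb : (c : ℕ) < mu r := by
        have := hmu r r' hr r'.2
        omega
      rw [dif_pos hb, dif_pos hb']
      exact h3 r r' ⟨c, hb⟩ ⟨c', hb'⟩ hr hc (Nat.zero_le _) (Nat.zero_le _)
    · rw [dif_neg hb']
      exact Fin.le_last _
  · simp only [glueFilling]
    split_ifs with hb
    · simp only [Fin.val_castSucc, hb, iff_true]
      exact Nat.lt_succ_iff.1 (Fin.is_lt _)
    · simp [hb]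

theorem prod_boxWeight_fiber (x t : ℕ → R) (h : ∀ r : Fin ℓ, mu r ≤ lam r)
    {T : YBox ℓ lam → Fin (n + 2)} (hT : T ∈ fiberRPP ℓ n lam mu) :
    ∏ b, boxWeight ℓ (n + 1) lam (fun _ => 0) x t T b =
      skewWeight ℓ lam mu (x (n + 1)) t *
        ∏ b, boxWeight ℓ n mu (fun _ => 0) x t (restrictFilling ℓ n lam mu h T) b := by
  have hv := restrictFilling_val h hT
  simp only [fiberRPP, Finset.mem_filter, Finset.mem_univ, true_and] at hT
  obtain ⟨⟨h1, h2, h3⟩, h4⟩ := hT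
  rw [Fintype.prod_sigma, Fintype.prod_sigma, skewWeight, ← Finset.prod_mul_distrib]
  refine Finset.prod_congr rfl fun r _ => prod_fin_split (h r) _ _ _ (fun c => ?_) fun c hc => ?_
  · have hiff : (∃ (hr : (r : ℕ) + 1 < ℓ) (hc : (c : ℕ) < lam ((r : ℕ) + 1)),
          T ⟨⟨(r : ℕ) + 1, hr⟩, ⟨c, hc⟩⟩ = T ⟨r, Fin.castLE (h r) c⟩) ↔
        ∃ (hr : (r : ℕ) + 1 < ℓ) (hc : (c : ℕ) < mu ((r : ℕ) + 1)),
          restrictFilling ℓ n lam mu h T ⟨⟨(r : ℕ) + 1, hr⟩, ⟨c, hc⟩⟩ =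
            restrictFilling ℓ n lam mu h T ⟨r, c⟩ := by
      constructor
      · rintro ⟨hr, hc, he⟩
        have hc' : (c : ℕ) < mu ((r : ℕ) + 1) := by
          refine (h4 ⟨⟨(r : ℕ) + 1, hr⟩, ⟨c, hc⟩⟩).1 ?_
          rw [he]
          exact (h4 ⟨r, Fin.castLE (h r) c⟩).2 c.2
        refine ⟨hr, hc', Fin.ext ?_⟩
        rw [hv, hv]
        exact congrArg Fin.val he
      · rintro ⟨hr, hc, he⟩
        refine ⟨hr, hc.trans_le (h ⟨_, hr⟩), Fin.ext ?_⟩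
        have := congrArg Fin.val he
        rw [hv, hv] at this
        exact this
    simp only [boxWeight, Nat.zero_le, if_true, hv]
    exact if_congr hiff rfl rfl
  · have hlast : ∀ (r' : Fin ℓ) (c' : Fin (lam r')), ¬ (c' : ℕ) < mu r' →
        T ⟨r', c'⟩ = Fin.last (n + 1) := by
      intro r' c' hc'
      have h5 : ¬ (T ⟨r', c'⟩ : ℕ) ≤ n := fun hh => hc' ((h4 ⟨r', c'⟩).1 hh)
      have h6 := (T ⟨r', c'⟩).2
      refine Fin.ext ?_
      rw [Fin.val_last]
      omega
    have e := hlast r c (by omega)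
    have hiff : (∃ (hr : (r : ℕ) + 1 < ℓ) (hc : (c : ℕ) < lam ((r : ℕ) + 1)),
          T ⟨⟨(r : ℕ) + 1, hr⟩, ⟨c, hc⟩⟩ = T ⟨r, c⟩) ↔
        (r : ℕ) + 1 < ℓ ∧ (c : ℕ) < lam (r + 1) := by
      constructor
      · rintro ⟨hr, hc, _⟩
        exact ⟨hr, hc⟩
      · rintro ⟨hr, hc'⟩
        refine ⟨hr, hc', ?_⟩
        have hle : T ⟨r, c⟩ ≤ T ⟨⟨(r : ℕ) + 1, hr⟩, ⟨c, hc'⟩⟩ :=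
          h3 r ⟨(r : ℕ) + 1, hr⟩ c ⟨c, hc'⟩ (Nat.le_succ _) rfl (Nat.zero_le _) (Nat.zero_le _)
        rw [e] at hle ⊢
        exact Fin.last_le_iff.1 hle
    simp only [boxWeight, Nat.zero_le, if_true]
    rw [if_congr hiff rfl rfl, e, Fin.val_last]

theorem sum_fiberRPP (x t : ℕ → R) (h : ∀ r : Fin ℓ, mu r ≤ lam r)
    (hmu : ∀ a b : ℕ, a ≤ b → b < ℓ → mu b ≤ mu a) :
    ∑ T ∈ fiberRPP ℓ n lam mu, ∏ b, boxWeight ℓ (n + 1) lam (fun _ => 0) x t T b =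
      skewWeight ℓ lam mu (x (n + 1)) t * dualGroth ℓ n mu (fun _ => 0) x t := by
  rw [dualGroth, Finset.mul_sum]
  refine Finset.sum_nbij' (restrictFilling ℓ n lam mu h) (glueFilling ℓ n lam mu) ?_ ?_ ?_ ?_ ?_
  · intro T hT
    simpa using restrictFilling_isSkewRPP h hT
  · intro T hT
    exact glueFilling_mem hmu (by simpa using hT)
  · intro T hT
    funext b
    refine Fin.ext ?_
    simp only [glueFilling]
    split_ifs with hb
    · rw [Fin.val_castSucc, restrictFilling_val h hT]
      rfl
    · simp only [fiberRPP, Finset.mem_filter, Finset.mem_univ, true_and] at hT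
      have h5 : ¬ (T b : ℕ) ≤ n := fun hh => hb ((hT.2 b).1 hh)
      have h6 := (T b).2
      rw [Fin.val_last]
      omega
  · intro T hT
    funext b
    refine Fin.ext ?_
    rw [restrictFilling_val h (glueFilling_mem hmu (by simpa using hT))]
    simp [glueFilling]
  · intro T hT
    exact prod_boxWeight_fiber x t h hT

theorem extendDep_apply (nu : ℕ → ℕ) (p : (i : Fin ℓ) → Fin (nu i.1 + 1)) (i : Fin ℓ) :
    extendDep ℓ nu p i = p i := by
  simp [extendDep]

theorem extendDep_antitone {nu : ℕ → ℕ} {p : (i : Fin ℓ) → Fin (nu i.1 + 1)}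
    (hp : ∀ i j : Fin ℓ, (i : ℕ) ≤ (j : ℕ) → (p j : ℕ) ≤ (p i : ℕ)) (a b : ℕ) (hab : a ≤ b)
    (hb : b < ℓ) : extendDep ℓ nu p b ≤ extendDep ℓ nu p a := by
  rw [extendDep, dif_pos hb, extendDep, dif_pos (hab.trans_lt hb)]
  exact hp ⟨a, hab.trans_lt hb⟩ ⟨b, hb⟩ hab

theorem dualGroth_succ (x t : ℕ → R) (hlam : ∀ a b : ℕ, a ≤ b → b < ℓ → lam b ≤ lam a) :
    dualGroth ℓ (n + 1) lam (fun _ => 0) x t =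
      ∑ p ∈ Finset.univ.filter (fun p : (i : Fin ℓ) → Fin (lam i.1 + 1) =>
          ∀ i j : Fin ℓ, (i : ℕ) ≤ (j : ℕ) → (p j : ℕ) ≤ (p i : ℕ)),
        skewWeight ℓ lam (extendDep ℓ lam p) (x (n + 1)) t *
          dualGroth ℓ n (extendDep ℓ lam p) (fun _ => 0) x t := by
  set g : (YBox ℓ lam → Fin (n + 2)) → (i : Fin ℓ) → Fin (lam i.1 + 1) := fun T i =>
    ⟨(Finset.univ.filter fun c : Fin (lam i) => (T ⟨i, c⟩ : ℕ) ≤ n).card,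
      Nat.lt_succ_iff.2 ((Finset.card_le_univ _).trans (Fintype.card_fin _).le)⟩ with hg
  have hgv : ∀ T, IsSkewRPP ℓ (n + 1) lam (fun _ => 0) T → ∀ b : YBox ℓ lam,
      (b.2 : ℕ) < g T b.1 ↔ (T b : ℕ) ≤ n := by
    intro T hT b
    exact lt_card_filter_iff (fun c : Fin (lam b.1) => (T ⟨b.1, c⟩ : ℕ))
      (fun c c' hc => hT.2.1 b.1 c c' (Nat.zero_le _) hc) b.2
  rw [dualGroth, ← Finset.sum_fiberwise_of_maps_to (g := g)
    (t := Finset.univ.filter (fun p : (i : Fin ℓ) → Fin (lam i.1 + 1) =>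
          ∀ i j : Fin ℓ, (i : ℕ) ≤ (j : ℕ) → (p j : ℕ) ≤ (p i : ℕ)))]
  · refine Finset.sum_congr rfl fun p hp => ?_
    simp only [Finset.mem_filter, Finset.mem_univ, true_and] at hp
    have hle : ∀ r : Fin ℓ, extendDep ℓ lam p r ≤ lam r := by
      intro r
      rw [extendDep_apply]
      exact Nat.lt_succ_iff.1 (p r).2
    rw [← sum_fiberRPP x t hle (extendDep_antitone hp)]
    refine Finset.sum_congr ?_ fun _ _ => rfl
    ext T
    simp only [fiberRPP, Finset.mem_filter, Finset.mem_univ, true_and]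
    refine and_congr_right fun hT => ⟨?_, fun hb => ?_⟩
    · rintro rfl b
      rw [extendDep_apply]
      exact (hgv T hT b).symm
    · funext r
      refine Fin.ext ?_
      have h1 : ∀ c : Fin (lam r), (c : ℕ) < g T r ↔ (c : ℕ) < p r := by
        intro c
        rw [hgv T hT ⟨r, c⟩, hb, extendDep_apply]
      have h2 := (g T r).2
      have h3 := (p r).2
      rcases lt_trichotomy (g T r : ℕ) (p r) with h | h | h
      · have := (h1 ⟨g T r, by omega⟩).2 h
        exact absurd this (lt_irrefl _)
      · exact h
      · have := (h1 ⟨p r, by omega⟩).1 h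
        exact absurd this (lt_irrefl _)
  · intro T hT
    simp only [Finset.mem_filter, Finset.mem_univ, true_and] at hT ⊢
    intro i j hij
    by_contra! hlt
    have h2 := (g T j).2
    have hji := hlam i j hij j.2
    have hlt' : (g T i : ℕ) < lam j := by omega
    have h5 := (hgv T hT ⟨j, ⟨g T i, hlt'⟩⟩).1 hlt
    have h6 : ¬ (T ⟨i, ⟨g T i, by omega⟩⟩ : ℕ) ≤ n := by
      rw [← hgv T hT ⟨i, ⟨g T i, by omega⟩⟩]
      exact lt_irrefl _
    have h7 : T ⟨i, ⟨g T i, by omega⟩⟩ ≤ T ⟨j, ⟨g T i, hlt'⟩⟩ :=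
      hT.2.2 i j _ _ hij rfl (Nat.zero_le _) (Nat.zero_le _)
    exact h6 (le_trans h7 h5)

theorem dualGroth_zero (x t : ℕ → R) :
    dualGroth ℓ 0 lam (fun _ => 0) x t = if ∀ r < ℓ, lam r = 0 then 1 else 0 := by
  rw [dualGroth]
  split_ifs with h
  · have : IsEmpty (YBox ℓ lam) := ⟨fun b => by have h1 := b.2.2; have h2 := h _ b.1.2; omega⟩
    have hu : Finset.univ.filter (IsSkewRPP ℓ 0 lam fun _ => 0) = Finset.univ := by
      refine Finset.filter_true_of_mem fun T _ => ?_
      exact ⟨fun b => isEmptyElim b, fun r c => isEmptyElim (⟨r, c⟩ : YBox ℓ lam),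
        fun r _ c => isEmptyElim (⟨r, c⟩ : YBox ℓ lam)⟩
    rw [hu]
    simp
  · push Not at h
    obtain ⟨r, hr, h⟩ := h
    refine Finset.sum_eq_zero fun T hT => ?_
    simp only [Finset.mem_filter, Finset.mem_univ, true_and] at hT
    have h1 := (hT.1 ⟨⟨r, hr⟩, ⟨0, Nat.pos_of_ne_zero h⟩⟩).1 (by omega)
    exact absurd h1 (Nat.not_lt_zero _)

end Branching

section JacobiTrudi

open PowerSeries

theorem hSeries_append (L M : List R) : hSeries (L ++ M) = hSeries L * hSeries M := by
  simp [hSeries]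

theorem hSeries_nil : hSeries ([] : List R) = 1 := by
  simp [hSeries]

theorem hSeries_singleton (a : R) : hSeries [a] = geomSeries a := by
  simp [hSeries]

theorem constantCoeff_hSeries (L : List R) : coeff 0 (hSeries L) = 1 := by
  induction L with
  | nil => simp [hSeries]
  | cons a L ih =>
    rw [hSeries, List.map_cons, List.prod_cons, mul_comm, coeff_zero_mul_geomSeries]
    exact ih

/-- The row lengths of `lam` read from the bottom and shifted to be strictly increasing. -/
def staircase (ℓ : ℕ) (lam : ℕ → ℕ) (s : ℕ) : ℕ := lam (ℓ - (s + 1)) + s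

/-- The generating series for the `s`-th row from the bottom in the Jacobi–Trudi formula for
dual Grothendieck polynomials. -/
def rowSeries (ℓ n : ℕ) (x t : ℕ → R) (s : ℕ) : PowerSeries R :=
  hSeries ((List.range n).map fun k => x (k + 1)) *
    hSeries ((List.range (ℓ - (s + 1))).map fun k => t (k + 1))

variable {ℓ n : ℕ} {lam mu : ℕ → ℕ}

theorem staircase_lt_succ (hlam : ∀ a b : ℕ, a ≤ b → b < ℓ → lam b ≤ lam a) {s : ℕ}
    (hs : s + 1 < ℓ) : staircase ℓ lam s < staircase ℓ lam (s + 1) := by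
  have := hlam (ℓ - (s + 1 + 1)) (ℓ - (s + 1)) (by omega) (by omega)
  simp only [staircase]
  omega

theorem staircase_rev (i : Fin ℓ) : staircase ℓ lam i = lam (Fin.rev i) + i := by
  rw [staircase, Fin.val_rev]

theorem staircase_extendDep (p : (i : Fin ℓ) → Fin (lam i.1 + 1)) (i : Fin ℓ) :
    staircase ℓ (extendDep ℓ lam p) i = p (Fin.rev i) + i := by
  rw [staircase_rev, extendDep_apply]

theorem staircase_lt (hlam : ∀ a b : ℕ, a ≤ b → b < ℓ → lam b ≤ lam a) {s : ℕ} (hs : s < ℓ) :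
    staircase ℓ lam s < lam 0 + ℓ := by
  have := hlam 0 (ℓ - (s + 1)) (by omega) (by omega)
  simp only [staircase]
  omega

theorem rowSeries_eq_mul (x t : ℕ → R) {s : ℕ} (hs : s + 1 < ℓ) :
    rowSeries ℓ n x t s = rowSeries ℓ n x t (s + 1) * geomSeries (t (ℓ - (s + 1))) := by
  have e : ℓ - (s + 1) = ℓ - (s + 1 + 1) + 1 := by omega
  rw [rowSeries, rowSeries, e, List.range_succ, List.map_append, hSeries_append, List.map_singleton,
    hSeries_singleton, mul_assoc]

theorem rowSeries_succ (x t : ℕ → R) (s : ℕ) :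
    rowSeries ℓ (n + 1) x t s = rowSeries ℓ n x t s * geomSeries (x (n + 1)) := by
  rw [rowSeries, rowSeries, List.range_succ, List.map_append, hSeries_append, List.map_singleton,
    hSeries_singleton, mul_right_comm]

theorem skewWeight_eq_prod_stripWeight (y : R) (t : ℕ → R) (h : ∀ r : Fin ℓ, mu r ≤ lam r) :
    skewWeight ℓ lam mu y t = ∏ i : Fin ℓ,
      stripWeight (staircase ℓ lam) (fun s => t (ℓ - (s + 1))) y i (staircase ℓ mu i) := by
  rw [skewWeight, ← Equiv.prod_comp Fin.revPerm]
  refine Finset.prod_congr rfl fun i _ => ?_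
  have h1 := h (Fin.rev i)
  rw [stripWeight, staircase_rev, staircase_rev, if_pos (by omega), Fin.revPerm_apply,
    ← Finset.prod_Ico_add_right_sub_eq (c := (i : ℕ))]
  refine Finset.prod_congr rfl fun c hc => ?_
  rw [Finset.mem_Ico] at hc
  have hi := i.2
  have e : (Fin.rev i : ℕ) + 1 = ℓ - i := by rw [Fin.val_rev]; omega
  rw [e]
  by_cases h0 : 0 < (i : ℕ)
  · have e1 : ℓ - ((i : ℕ) - 1 + 1) = ℓ - i := by omega
    simp only [staircase, e1]
    refine if_congr ?_ rfl rfl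
    omega
  · rw [if_neg (by omega), if_neg (by omega)]

/-- The Jacobi–Trudi formula for refined dual Grothendieck polynomials. -/
theorem dualGroth_eq_det (x t : ℕ → R) (hlam : ∀ a b : ℕ, a ≤ b → b < ℓ → lam b ≤ lam a) :
    dualGroth ℓ n lam (fun _ => 0) x t = Matrix.det (Matrix.of fun i : Fin ℓ =>
      coeffRow ℓ (rowSeries ℓ n x t i) (staircase ℓ lam i)) := by
  induction n generalizing lam with
  | zero =>
    rw [dualGroth_zero]
    split_ifs with h
    · have hs : ∀ i : Fin ℓ, staircase ℓ lam i = i := by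
        intro i
        rw [staircase_rev, h _ (Fin.rev i).2, zero_add]
      rw [Matrix.det_of_isLowerTriangular]
      · refine (Finset.prod_eq_one fun i _ => ?_).symm
        simp only [Matrix.of_apply, coeffRow, hs, rowSeries, coeff_X_pow_mul', le_refl, if_true,
          Nat.sub_self, List.range_zero, List.map_nil, hSeries_nil, one_mul,
          constantCoeff_hSeries]
      · intro i j hij
        have hij' : (i : ℕ) < j := hij
        simp only [Matrix.of_apply, coeffRow, hs, coeff_X_pow_mul']
        rw [if_neg (by omega)]
    · push Not at h
      obtain ⟨r, hr, h⟩ := h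
      refine (Matrix.det_eq_zero_of_row_eq_zero (⟨ℓ - 1, by omega⟩ : Fin ℓ) fun j => ?_).symm
      have h0 := hlam 0 r (Nat.zero_le _) hr
      have e : ℓ - (ℓ - 1 + 1) = 0 := by omega
      simp only [Matrix.of_apply, coeffRow, rowSeries, staircase, e, List.range_zero,
        List.map_nil, hSeries_nil, mul_one, coeff_X_pow]
      have := j.2
      rw [if_neg (by omega)]
  | succ n ih =>
    set τ : ℕ → R := fun s => t (ℓ - (s + 1)) with hτ
    set f : (Fin ℓ → ℕ) → R := fun a =>
      (∏ i : Fin ℓ, stripWeight (staircase ℓ lam) τ (x (n + 1)) i (a i)) *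
        Matrix.det (Matrix.of fun i : Fin ℓ => coeffRow ℓ (rowSeries ℓ n x t i) (a i)) with hf
    have hN : ∀ s < ℓ, staircase ℓ lam s < lam 0 + ℓ := fun s hs => staircase_lt hlam hs
    rw [dualGroth_succ x t hlam]
    simp only [rowSeries_succ]
    rw [det_mul_geomSeries_eq_sum ℓ (lam 0 + ℓ) (rowSeries ℓ n x t) τ (x (n + 1))
      (fun s hs => rowSeries_eq_mul x t hs) (staircase ℓ lam)
      (fun s hs => staircase_lt_succ hlam hs) hN,
      ← sum_partitions_eq_sum_incSeq ℓ (lam 0 + ℓ) lam f]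
    · refine Finset.sum_congr rfl fun p hp => ?_
      simp only [Finset.mem_filter, Finset.mem_univ, true_and] at hp
      rw [ih (extendDep_antitone hp), skewWeight_eq_prod_stripWeight]
      · simp only [hf, hτ, staircase_extendDep]
      · intro r
        rw [extendDep_apply]
        exact Nat.lt_succ_iff.1 (p r).2
    · intro i
      rw [← staircase_rev]
      exact hN i i.2
    · intro a _ ha i
      rw [← staircase_rev]
      by_contra hlt
      refine ha ?_
      rw [hf]
      refine mul_eq_zero_of_left (Finset.prod_eq_zero (Finset.mem_univ i) ?_) _
      rw [stripWeight, if_neg hlt]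

end JacobiTrudi

section Schur

open PowerSeries

/-- The Schur polynomial is the dual Grothendieck polynomial at `t = 0`. -/
theorem schurPoly_eq_dualGroth {ℓ N : ℕ} {nu : ℕ → ℕ}
    (hnu : ∀ a b : ℕ, a ≤ b → b < ℓ → nu b ≤ nu a) (z : ℕ → R) :
    schurPoly ℓ N nu z = dualGroth ℓ N nu (fun _ => 0) z (fun _ => 0) := by
  rw [schurPoly, dualGroth]
  have hsub : Finset.univ.filter (IsSSYT ℓ N nu) ⊆
      Finset.univ.filter (IsSkewRPP ℓ N nu fun _ => 0) := by
    intro T hT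
    simp only [Finset.mem_filter, Finset.mem_univ, true_and] at hT ⊢
    obtain ⟨h1, h2, h3⟩ := hT
    refine ⟨fun b => ?_, fun r c c' _ hc => h2 r c c' hc, fun r r' c c' hr hc _ _ => ?_⟩
    · have := h1 b
      simp only [Nat.not_lt_zero, iff_false]
      omega
    · rcases hr.eq_or_lt with h | h
      · obtain rfl : r = r' := Fin.ext h
        exact h2 r c c' hc.le
      · exact (h3 r r' c c' h hc).le
  refine Eq.trans (Finset.sum_congr rfl fun T hT => ?_) (Finset.sum_subset hsub fun T hT hT' => ?_)
  · simp only [Finset.mem_filter, Finset.mem_univ, true_and] at hT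
    refine Finset.prod_congr rfl fun b _ => ?_
    rw [boxWeight, if_pos (Nat.zero_le _), if_neg]
    rintro ⟨hr, hc, he⟩
    exact (hT.2.2 b.1 ⟨_, hr⟩ b.2 ⟨_, hc⟩ (Nat.lt_succ_self _) rfl).ne' he
  · simp only [Finset.mem_filter, Finset.mem_univ, true_and] at hT hT'
    obtain ⟨h1, h2, h3⟩ := hT
    by_contra hne
    refine hT' ⟨fun b => ?_, fun r c c' hc => h2 r c c' (Nat.zero_le _) hc,
      fun r r' c c' hr hc => ?_⟩
    · have := h1 b
      simp only [Nat.not_lt_zero, iff_false] at this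
      omega
    · have hr1 : (r : ℕ) + 1 < ℓ := lt_of_le_of_lt hr r'.2
      have hc1 : (c : ℕ) < nu ((r : ℕ) + 1) := by
        have := hnu ((r : ℕ) + 1) r' hr r'.2
        have := c'.2
        omega
      refine lt_of_lt_of_le (lt_of_le_of_ne (h3 r ⟨_, hr1⟩ c ⟨c, hc1⟩ (Nat.le_succ _) rfl
        (Nat.zero_le _) (Nat.zero_le _)) fun he => hne ?_)
        (h3 ⟨_, hr1⟩ r' ⟨c, hc1⟩ c' hr hc (Nat.zero_le _) (Nat.zero_le _))
      refine Finset.prod_eq_zero (Finset.mem_univ (⟨r, c⟩ : YBox ℓ nu)) ?_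
      rw [boxWeight, if_pos (Nat.zero_le _), if_pos ⟨hr1, hc1, he.symm⟩]

theorem hSeries_replicate_zero (k : ℕ) : hSeries (List.replicate k (0 : R)) = 1 := by
  have h : geomSeries (0 : R) = 1 := by
    ext n
    simp [geomSeries, coeff_one, zero_pow_eq]
  simp [hSeries, h]

/-- The Jacobi–Trudi formula. -/
theorem schurPoly_eq_det {ℓ N : ℕ} {nu : ℕ → ℕ}
    (hnu : ∀ a b : ℕ, a ≤ b → b < ℓ → nu b ≤ nu a) (z : ℕ → R) :
    schurPoly ℓ N nu z = Matrix.det (Matrix.of fun i : Fin ℓ =>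
      coeffRow ℓ (hSeries ((List.range N).map fun k => z (k + 1))) (staircase ℓ nu i)) := by
  rw [schurPoly_eq_dualGroth hnu, dualGroth_eq_det _ _ hnu]
  simp only [rowSeries, List.map_const', hSeries_replicate_zero, mul_one]

theorem hL_zero (L : List R) : hL 0 L = 1 := by
  have : Finset.univ.filter (fun f : Fin 0 → Fin L.length => Monotone f) = Finset.univ :=
    Finset.filter_true_of_mem fun f _ i => i.elim0
  rw [hL, this]
  simp

theorem hL_succ_nil (k : ℕ) : hL (k + 1) ([] : List R) = 0 := by
  rw [hL]
  refine Finset.sum_eq_zero fun f _ => ?_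
  exact (f 0).elim0

theorem hL_succ_cons (k : ℕ) (a : R) (L : List R) :
    hL (k + 1) (a :: L) = hL (k + 1) L + a * hL k (a :: L) := by
  rw [hL, ← Finset.sum_filter_add_sum_filter_not _ (fun f => f 0 ≠ 0)]
  congr 1
  · symm
    refine Finset.sum_bij (fun f _ => fun i => (f i).succ) ?_ ?_ ?_ ?_
    · intro f hf
      simp only [Finset.mem_filter, Finset.mem_univ, true_and] at hf ⊢
      exact ⟨fun i j hij => Fin.succ_le_succ_iff.2 (hf hij), Fin.succ_ne_zero _⟩
    · intro f _ g _ h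
      funext i
      exact Fin.succ_injective _ (congrFun h i)
    · intro f hf
      simp only [Finset.mem_filter, Finset.mem_univ, true_and] at hf
      have h0 : ∀ i, f i ≠ 0 := fun i hi => hf.2 (Fin.le_zero_iff.1 (hi ▸ hf.1 (Fin.zero_le i)))
      refine ⟨fun i => (f i).pred (h0 i), ?_, ?_⟩
      · simp only [Finset.mem_filter, Finset.mem_univ, true_and]
        exact fun i j hij => Fin.pred_le_pred_iff.2 (hf.1 hij)
      · funext i
        exact Fin.succ_pred _ _
    · intro f _
      rfl
  · rw [hL, Finset.mul_sum]
    symm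
    refine Finset.sum_bij (fun f _ => Fin.cons 0 f) ?_ ?_ ?_ ?_
    · intro f hf
      simp only [Finset.mem_filter, Finset.mem_univ, true_and] at hf
      simp only [Finset.mem_filter, Finset.mem_univ, true_and, Fin.cons_zero, not_not, and_true]
      intro i j hij
      induction i using Fin.cases with
      | zero => exact Fin.zero_le _
      | succ i =>
        induction j using Fin.cases with
        | zero => exact absurd hij (not_le.2 (Fin.succ_pos i))
        | succ j =>
          simp only [Fin.cons_succ]
          exact hf (Fin.succ_le_succ_iff.1 hij)
    · intro f _ g _ h
      exact (Fin.cons_injective2 h).2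
    · intro f hf
      simp only [Finset.mem_filter, Finset.mem_univ, true_and, not_not] at hf
      refine ⟨Fin.tail f, ?_, ?_⟩
      · simp only [Finset.mem_filter, Finset.mem_univ, true_and]
        exact fun i j hij => hf.1 (Fin.succ_le_succ_iff.2 hij)
      · rw [← hf.2]
        exact Fin.cons_self_tail f
    · intro f _
      rw [Fin.prod_univ_succ]
      rfl

theorem hL_eq_coeff (k : ℕ) (L : List R) : hL k L = coeff k (hSeries L) := by
  induction L generalizing k with
  | nil =>
    cases k with
    | zero => simp [hL_zero, hSeries_nil]
    | succ k => rw [hL_succ_nil, hSeries_nil, coeff_one, if_neg k.succ_ne_zero]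
  | cons a L ihL =>
    have e : hSeries (a :: L) = hSeries L * geomSeries a := by
      rw [hSeries, List.map_cons, List.prod_cons, mul_comm, hSeries]
    induction k with
    | zero => rw [hL_zero, constantCoeff_hSeries]
    | succ k ih => rw [hL_succ_cons, ihL, ih, e, coeff_succ_mul_geomSeries]

theorem hInt_sub_eq_coeff (a b : ℕ) (L : List R) :
    hInt ((a : ℤ) - b) L = coeff a (X ^ b * hSeries L) := by
  rw [hInt, coeff_X_pow_mul']
  by_cases h : b ≤ a
  · rw [if_pos (by omega), if_pos h, hL_eq_coeff]
    congr
    omega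
  · rw [if_neg (by omega), if_neg h]

end Schur

section Expansion

open PowerSeries

variable {ℓ m n : ℕ} {nu : ℕ → ℕ}

/-- A square matrix with a block of zeros in the rows `≥ i₀` and columns `≤ i₀` is singular. -/
theorem det_eq_zero_of_corner (M : Matrix (Fin ℓ) (Fin ℓ) R) (i₀ : Fin ℓ)
    (h : ∀ i j, i₀ ≤ i → j ≤ i₀ → M i j = 0) : M.det = 0 := by
  rw [Matrix.det_apply]
  refine Finset.sum_eq_zero fun σ _ => ?_
  obtain ⟨j, hj, hσ⟩ : ∃ j, j ≤ i₀ ∧ i₀ ≤ σ j := by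
    by_contra! hc
    have hsub : (Finset.Iic i₀).image σ ⊆ Finset.Iio i₀ := by
      intro i hi
      obtain ⟨j, hj, rfl⟩ := Finset.mem_image.1 hi
      exact Finset.mem_Iio.2 (hc j (Finset.mem_Iic.1 hj))
    have := Finset.card_le_card hsub
    rw [Finset.card_image_of_injective _ σ.injective, Fin.card_Iic, Fin.card_Iio] at this
    omega
  have h0 : ∏ i, M (σ i) i = 0 := Finset.prod_eq_zero (Finset.mem_univ j) (h _ _ hσ hj)
  rw [h0, smul_zero]

/-- The generating series of the variables `t` that occur in the `s`-th column from the right of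
the matrix of coefficients of the expansion. -/
def colSeries (ℓ m : ℕ) (t : ℕ → R) (s : ℕ) : PowerSeries R :=
  hSeries ((List.range (m - (ℓ - (s + 1)))).map fun k => t (ℓ - (s + 1) + 1 + k))

theorem colSeries_succ (t : ℕ → R) (hm : ℓ - 1 ≤ m) {s : ℕ} (hs : s + 1 < ℓ) :
    colSeries ℓ m t (s + 1) = colSeries ℓ m t s * geomSeries (t (ℓ - (s + 1))) := by
  obtain ⟨j, hj⟩ : ∃ j, ℓ - (s + 1) = j + 1 := ⟨ℓ - (s + 1) - 1, by omega⟩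
  have hj' : ℓ - (s + 1 + 1) = j := by omega
  have e : m - j = m - (j + 1) + 1 := by omega
  rw [colSeries, colSeries, hj, hj', e, List.range_succ_eq_map, List.map_cons, List.map_map, hSeries,
    List.map_cons, List.prod_cons, mul_comm, hSeries]
  congr 4
  funext k
  simp only [Function.comp_apply, Nat.succ_eq_add_one]
  congr 1
  omega

theorem rowSeries_mul_colSeries (x t : ℕ → R) (hm : ℓ - 1 ≤ m) :
    rowSeries ℓ n x t 0 * colSeries ℓ m t 0 =
      hSeries ((List.range (n + m)).map fun k => if k + 1 ≤ n then x (k + 1) else t (k + 1 - n)) := by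
  obtain ⟨d, hd⟩ := Nat.exists_eq_add_of_le hm
  have e : m - (ℓ - (0 + 1)) = d := by omega
  rw [rowSeries, colSeries, mul_assoc, ← hSeries_append, ← hSeries_append, e, hd, zero_add]
  congr 1
  rw [List.range_add, List.range_add, List.map_append, List.map_append, List.map_append]
  simp only [List.map_map]
  congr 1
  · refine List.map_congr_left fun k hk => ?_
    rw [List.mem_range] at hk
    rw [if_pos (by omega)]
  · congr 1
    · refine List.map_congr_left fun k _ => ?_
      simp only [Function.comp_apply]
      rw [if_neg (by omega)]
      congr 1
      omega
    · refine List.map_congr_left fun k _ => ?_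
      simp only [Function.comp_apply]
      rw [if_neg (by omega)]
      congr 1
      omega

/-- The coefficients of `X ^ a * Q` in the degrees given by the staircase of `nu`. -/
def staircaseRow (ℓ : ℕ) (nu : ℕ → ℕ) (Q : PowerSeries R) (a : ℕ) : Fin ℓ → R :=
  fun i => coeff (staircase ℓ nu i) (X ^ a * Q)

theorem staircaseRow_mul_geomSeries (Q : PowerSeries R) (y : R) (a : ℕ) :
    staircaseRow ℓ nu (Q * geomSeries y) a =
      staircaseRow ℓ nu Q a + y • staircaseRow ℓ nu (Q * geomSeries y) (a + 1) := by
  funext i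
  have e (P : PowerSeries R) : X ^ (a + 1) * P = X * (X ^ a * P) := by rw [pow_succ', mul_assoc]
  simp only [staircaseRow, Pi.add_apply, Pi.smul_apply, smul_eq_mul, e, ← mul_assoc (X ^ a)]
  cases staircase ℓ nu i with
  | zero => rw [coeff_zero_mul_geomSeries, coeff_zero_X_mul, mul_zero, add_zero]
  | succ k => rw [coeff_succ_X_mul, coeff_succ_mul_geomSeries]

theorem staircaseRow_eq_zero (hnu : ∀ a b : ℕ, a ≤ b → b < ℓ → nu b ≤ nu a) (Q : PowerSeries R) :
    staircaseRow ℓ nu Q (nu 0 + ℓ) = 0 := by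
  funext i
  have := staircase_lt hnu i.2
  rw [staircaseRow, coeff_X_pow_mul', if_neg (by omega), Pi.zero_apply]

theorem staircase_mono (hnu : ∀ a b : ℕ, a ≤ b → b < ℓ → nu b ≤ nu a) {i j : Fin ℓ} (h : i ≤ j) :
    staircase ℓ nu i ≤ staircase ℓ nu j := by
  have h1 : (i : ℕ) ≤ j := h
  have := hnu (ℓ - (j + 1)) (ℓ - (i + 1)) (by omega) (by omega)
  simp only [staircase]
  omega

theorem det_hInt_eq (t : ℕ → R) (p : (i : Fin ℓ) → Fin (nu i.1 + 1)) :
    Matrix.det (Matrix.of fun i j : Fin ℓ =>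
          hInt ((nu i.1 : ℤ) - ((p j : ℕ) : ℤ) + (j.1 : ℤ) - (i.1 : ℤ))
            ((List.range (m - j.1)).map fun k => t (j.1 + 1 + k))) =
      Matrix.det (Matrix.of fun i : Fin ℓ =>
        staircaseRow ℓ nu (colSeries ℓ m t i) (p (Fin.rev i) + i)) := by
  rw [← Matrix.det_submatrix_equiv_self Fin.revPerm, ← Matrix.det_transpose]
  congr 1
  ext i j
  simp only [Matrix.transpose_apply, Matrix.submatrix_apply, Matrix.of_apply, Fin.revPerm_apply,
    staircaseRow, colSeries, staircase_rev]
  have hi := Fin.val_rev i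
  have hj := Fin.val_rev j
  rw [← hInt_sub_eq_coeff, ← hi]
  congr 1
  push_cast
  omega

theorem sum_smul_coeffRow (P Q : PowerSeries R) (N c : ℕ) (hc : c < N) :
    ∑ a ∈ Finset.range N, coeff c (X ^ a * Q) • coeffRow ℓ P a = coeffRow ℓ (P * Q) c := by
  funext i
  simp only [Finset.sum_apply, Pi.smul_apply, coeffRow, smul_eq_mul, ← mul_assoc]
  rw [coeff_mul, Finset.Nat.sum_antidiagonal_eq_sum_range_succ_mk,
    ← Finset.sum_subset (Finset.range_subset_range.2 hc)]
  · refine Finset.sum_congr rfl fun a ha => ?_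
    rw [Finset.mem_range] at ha
    rw [coeff_X_pow_mul', if_pos (by omega), mul_comm]
  · intro a _ ha
    rw [Finset.mem_range] at ha
    rw [coeff_X_pow_mul', if_neg (by omega), zero_mul]

theorem sum_det_staircaseRow_mul_det_coeffRow (hm : ℓ - 1 ≤ m)
    (hnu : ∀ a b : ℕ, a ≤ b → b < ℓ → nu b ≤ nu a) (x t : ℕ → R) :
    ∑ a ∈ incSeq (nu 0 + ℓ) ℓ 0,
        Matrix.det (Matrix.of fun i : Fin ℓ => staircaseRow ℓ nu (colSeries ℓ m t i) (a i)) *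
          Matrix.det (Matrix.of fun i : Fin ℓ => coeffRow ℓ (rowSeries ℓ n x t i) (a i)) =
      Matrix.det (Matrix.of fun i : Fin ℓ =>
        coeffRow ℓ (rowSeries ℓ n x t 0 * colSeries ℓ m t 0) (staircase ℓ nu i)) := by
  have h := flagSum_eq_pairSum (nu 0 + ℓ) (fun s => staircaseRow ℓ nu (colSeries ℓ m t s))
    (fun s => coeffRow ℓ (rowSeries ℓ n x t s)) (fun s => t (ℓ - (s + 1))) ℓ
    (fun s hs a => by
      rw [colSeries_succ t hm hs]
      exact staircaseRow_mul_geomSeries _ _ _)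
    (fun s => staircaseRow_eq_zero hnu _)
    (fun s hs => by
      rw [rowSeries_eq_mul x t hs]
      exact coeffRow_zero _ _ _)
    (fun s hs a => by
      rw [rowSeries_eq_mul x t hs]
      exact coeffRow_succ _ _ _ _)
    ℓ 0 0 (by omega) Matrix.detRowAlternating Matrix.detRowAlternating
  simp only [flagSum, pairSum, zero_add] at h
  refine h.trans ?_
  have hcb := cauchy_binet ℓ (nu 0 + ℓ) (Matrix.detRowAlternating (n := Fin ℓ) (R := R))
    (fun i a => coeff (staircase ℓ nu i) (X ^ a * colSeries ℓ m t 0))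
    (coeffRow ℓ (rowSeries ℓ n x t 0))
  simp only [fun i : Fin ℓ => sum_smul_coeffRow (ℓ := ℓ) (rowSeries ℓ n x t 0) (colSeries ℓ m t 0)
    (nu 0 + ℓ) (staircase ℓ nu i) (staircase_lt hnu i.2)] at hcb
  refine Eq.trans (Finset.sum_congr rfl fun a _ => ?_) hcb.symm
  congr 1
  exact (Matrix.det_transpose _).symm

end Expansion

/-- **Schur polynomials expand in refined dual Grothendieck polynomials.**
For a partition `ν` with exactly `ℓ` positive parts and `t̃ = (t_1,…,t_m)` with
`m ≥ ℓ-1`: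
`s_ν(x_1,…,x_n,t_1,…,t_m) = Σ_{λ ⊆ ν} p_ν^λ(t̃) g_λ(x;t)`, where
`p_ν^λ(t̃) = det[ h_{ν_i-λ_j-i+j}(t_j,…,t_m) ]_{i,j=1}^{ℓ}`. -/
theorem schur_expansion_in_refined_dual_grothendieck
    {R : Type*} [CommRing R] (ℓ m n : ℕ) (hl : 1 ≤ ℓ) (hm : ℓ - 1 ≤ m)
    (nu : ℕ → ℕ)
    (hnu : ∀ a b : ℕ, a ≤ b → b < ℓ → nu b ≤ nu a)
    (hpos : ∀ r : ℕ, r < ℓ → 0 < nu r)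
    (x t : ℕ → R) :
    schurPoly ℓ (n + m) nu (fun k => if k ≤ n then x k else t (k - n)) =
      ∑ p ∈ Finset.univ.filter
          (fun p : (i : Fin ℓ) → Fin (nu i.1 + 1) =>
            ∀ i j : Fin ℓ, (i : ℕ) ≤ (j : ℕ) → (p j : ℕ) ≤ (p i : ℕ)),
        Matrix.det (Matrix.of fun i j : Fin ℓ =>
          hInt ((nu i.1 : ℤ) - ((p j : ℕ) : ℤ) + (j.1 : ℤ) - (i.1 : ℤ))
            ((List.range (m - j.1)).map fun k => t (j.1 + 1 + k))) *
          dualGroth ℓ n (extendDep ℓ nu p) (fun _ => 0) x t := by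
  set f : (Fin ℓ → ℕ) → R := fun a =>
    Matrix.det (Matrix.of fun i : Fin ℓ => staircaseRow ℓ nu (colSeries ℓ m t i) (a i)) *
      Matrix.det (Matrix.of fun i : Fin ℓ => coeffRow ℓ (rowSeries ℓ n x t i) (a i)) with hf
  rw [schurPoly_eq_det hnu, ← rowSeries_mul_colSeries x t hm,
    ← sum_det_staircaseRow_mul_det_coeffRow hm hnu, ← sum_partitions_eq_sum_incSeq ℓ _ nu f]
  · refine Finset.sum_congr rfl fun p hp => ?_
    simp only [Finset.mem_filter, Finset.mem_univ, true_and] at hp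
    rw [det_hInt_eq, dualGroth_eq_det x t (extendDep_antitone hp)]
    simp only [hf, staircase_extendDep]
  · intro i
    rw [← staircase_rev]
    exact staircase_lt hnu i.2
  · intro a ha hne i
    rw [← staircase_rev]
    by_contra! hlt
    refine hne (mul_eq_zero_of_left (det_eq_zero_of_corner _ i fun i' j hi hj => ?_) _)
    have h1 := (mem_incSeq.1 ha).2.monotone hi
    have h2 := staircase_mono hnu hj
    rw [Matrix.of_apply, staircaseRow, PowerSeries.coeff_X_pow_mul', if_neg (by omega)]

end
end

section
/- Fix ℓ ≥ 1 and a commutative ring R (e.g. ℂ) containing parameters t_1,…,t_{ℓ−1}. Let f, g : ℤ → R be functions such that for some M ∈ ℤ, f(ν) = g(ν) = 0 for all ν < M. Define the convolution (f∗g)(ν) = Σ_{ξ∈ℤ} f(ν−ξ) g(ξ) (a finite sum). With the operators Δ_{t}f(ν) = f(ν+1) − t f(ν), Δ_{t}^{−1}f(ν) = Σ_{μ<ν} t^{ν−1−μ} f(μ) (a finite sum by the support assumption), and Δ_t^{j−i} := Δ_{t_i}⋯Δ_{t_{j−1}} for j ≥ i, Δ_t^{j−i} := Δ_{t_j}^{−1}⋯Δ_{t_{i−1}}^{−1}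 for j < i, the following holds for all partitions λ, μ with at most ℓ parts: Σ_{ν_ℓ ≤ … ≤ ν_2 ≤ ν_1} det[ Δ_t^{j−i} f(ν_i − μ_j) ]_{i,j=1}^{ℓ} · det[ Δ_t^{j−i} g(λ_i − ν_j) ]_{i,j=1}^{ℓ} = det[ (Δ_t^{j−i}(f∗g))(λ_i − μ_j) ]_{i,j=1}^{ℓ}, where the sum is over weakly decreasing integer tuples (ν_1,…,ν_ℓ) (only finitely many terms are nonzero). -/
open scoped Classical

noncomputable section

variable {R : Type*} [CommRing R]

/-- The `t`-weighted forward difference operator `Δ_t f (ν) = f(ν+1) - t f(ν)`. -/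
def Dop (t : R) (f : ℤ → R) : ℤ → R := fun ν => f (ν + 1) - t * f ν

/-- The inverse operator `Δ_t⁻¹ f (ν) = Σ_{μ < ν} t^{ν-1-μ} f(μ)` (a finite sum
whenever `f` is supported bounded below). -/
def Dinv (t : R) (f : ℤ → R) : ℤ → R := fun ν =>
  ∑ᶠ μ : ℤ, if μ < ν then t ^ (ν - 1 - μ).toNat * f μ else 0

/-- `k`-fold composition `Δ_{t_a} Δ_{t_{a+1}} ⋯ Δ_{t_{a+k-1}}`. -/
def DopIter (t : ℕ → R) (a : ℕ) : ℕ → (ℤ → R) → ℤ → R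
  | 0 => fun f => f
  | k + 1 => fun f => Dop (t a) (DopIter t (a + 1) k f)

/-- `k`-fold composition `Δ_{t_a}⁻¹ Δ_{t_{a+1}}⁻¹ ⋯ Δ_{t_{a+k-1}}⁻¹`. -/
def DinvIter (t : ℕ → R) (a : ℕ) : ℕ → (ℤ → R) → ℤ → R
  | 0 => fun f => f
  | k + 1 => fun f => Dinv (t a) (DinvIter t (a + 1) k f)

/-- The multiple weighted difference operator `Δ_t^{j-i}`: for `i ≤ j` it is
`Δ_{t_i} Δ_{t_{i+1}} ⋯ Δ_{t_{j-1}}`, and for `j < i` it is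
`Δ_{t_j}⁻¹ Δ_{t_{j+1}}⁻¹ ⋯ Δ_{t_{i-1}}⁻¹`. -/
def Dmulti (t : ℕ → R) (i j : ℕ) (f : ℤ → R) : ℤ → R :=
  if i ≤ j then DopIter t i (j - i) f else DinvIter t j (i - j) f

/-- The convolution `(f∗g)(ν) = Σ_{ξ ∈ ℤ} f(ν-ξ) g(ξ)` (a finite sum whenever
`f` and `g` are supported bounded below). -/
def conv (f g : ℤ → R) : ℤ → R := fun ν => ∑ᶠ ξ : ℤ, f (ν - ξ) * g ξ

/-! ### Finite-box Cauchy–Binet over weakly decreasing tuples -/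

theorem exists_perm_antitone_comp {α : Type*} [LinearOrder α] {n : ℕ} (v : Fin n → α) :
    ∃ σ : Equiv.Perm (Fin n), Antitone (v ∘ σ) :=
  ⟨Tuple.sort (OrderDual.toDual ∘ v), fun _ _ h =>
    Tuple.monotone_sort (OrderDual.toDual ∘ v) h⟩

theorem sum_perm_ite_antitone {α : Type*} [LinearOrder α] {n : ℕ} {v : Fin n → α}
    (hv : Function.Injective v) (c : R) :
    ∑ σ : Equiv.Perm (Fin n), (if Antitone (v ∘ σ) then c else 0) = c := by
  obtain ⟨τ, hτ⟩ := exists_perm_antitone_comp v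
  rw [Finset.sum_eq_single τ, if_pos hτ]
  · intro σ _ hσ
    refine if_neg fun h => hσ ?_
    ext i
    exact congrArg _ (hv (congrFun (Tuple.unique_antitone h hτ) i))
  · simp

/-- Cauchy–Binet for sums over a finite subset of a linear order. -/
theorem det_sum_mul_eq_sum_antitone {α : Type*} [LinearOrder α] {n : ℕ} (s : Finset α)
    (p q : Fin n → α → R) :
    ∑ v ∈ Fintype.piFinset fun _ : Fin n => s,
        (if Antitone v then
          Matrix.det (Matrix.of fun i j => q j (v i)) *
            Matrix.det (Matrix.of fun i j => p j (v i)) else 0) =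
      Matrix.det (Matrix.of fun i j => ∑ x ∈ s, p i x * q j x) := by
  set T : (Fin n → α) → R := fun v =>
    (∏ i, p i (v i)) * Matrix.det (Matrix.of fun i j => q j (v i)) with hT
  have hrhs : Matrix.det (Matrix.of fun i j => ∑ x ∈ s, p i x * q j x) =
      ∑ v ∈ Fintype.piFinset fun _ : Fin n => s, T v := by
    have h := (Matrix.detRowAlternating (n := Fin n) (R := R)).toMultilinearMap.map_sum_finset
      (fun i x => p i x • fun j => q j x) (fun _ => s)
    have h' : (fun i => ∑ x ∈ s, p i x • fun j => q j x) =
        Matrix.of fun i j => ∑ x ∈ s, p i x * q j x := by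
      ext i j
      simp [Finset.sum_apply]
    rw [h'] at h
    refine h.trans (Finset.sum_congr rfl fun v _ => ?_)
    exact MultilinearMap.map_smul_univ _ (fun i => p i (v i)) (fun i j => q j (v i))
  have hT0 : ∀ v, ¬ Function.Injective v → T v = 0 := by
    intro v hv
    simp only [Function.Injective, not_forall] at hv
    obtain ⟨i, j, hij, hne⟩ := hv
    have : Matrix.det (Matrix.of fun i j => q j (v i)) = 0 :=
      Matrix.det_zero_of_row_eq hne (by ext k; simp [hij])
    simp [hT, this]
  have hsort : ∀ v, T v = ∑ σ : Equiv.Perm (Fin n), (if Antitone (v ∘ σ) then T v else 0) := by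
    intro v
    by_cases hv : Function.Injective v
    · exact (sum_perm_ite_antitone hv _).symm
    · simp [hT0 v hv]
  have hperm : ∀ (σ : Equiv.Perm (Fin n)) (v : Fin n → α),
      T (v ∘ σ.symm) = Matrix.det (Matrix.of fun i j => q j (v i)) *
        (((Equiv.Perm.sign σ : ℤ) : R) * ∏ i, p (σ i) (v i)) := by
    intro σ v
    have h1 : Matrix.det (Matrix.of fun i j => q j ((v ∘ σ.symm) i)) =
        ((Equiv.Perm.sign σ : ℤ) : R) * Matrix.det (Matrix.of fun i j => q j (v i)) := by
      have := Matrix.det_permute σ.symm (Matrix.of fun i j => q j (v i))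
      rw [Equiv.Perm.sign_symm] at this
      exact this
    have h2 : ∏ i, p i ((v ∘ σ.symm) i) = ∏ i, p (σ i) (v i) := by
      rw [← Equiv.prod_comp σ]
      simp
    simp only [hT]
    rw [h1, h2]
    ring
  rw [hrhs, Finset.sum_congr rfl fun v _ => hsort v, Finset.sum_comm]
  have hre : ∀ σ : Equiv.Perm (Fin n),
      ∑ v ∈ Fintype.piFinset (fun _ : Fin n => s), (if Antitone (v ∘ σ) then T v else 0) =
      ∑ v ∈ Fintype.piFinset (fun _ : Fin n => s),
        (if Antitone v then T (v ∘ σ.symm) else 0) := by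
    intro σ
    refine Finset.sum_bij' (fun v _ => v ∘ σ) (fun v _ => v ∘ σ.symm) ?_ ?_ ?_ ?_ ?_
    · intro v hv
      simp only [Fintype.mem_piFinset, Function.comp] at hv ⊢
      exact fun i => hv _
    · intro v hv
      simp only [Fintype.mem_piFinset, Function.comp] at hv ⊢
      exact fun i => hv _
    · intro v _
      ext; simp
    · intro v _
      ext; simp
    · intro v _
      simp [Function.comp_assoc]
  rw [Finset.sum_congr rfl fun σ _ => hre σ, Finset.sum_comm]
  refine Finset.sum_congr rfl fun v _ => ?_
  split_ifs with h
  · rw [Finset.sum_congr rfl fun σ _ => hperm σ v, ← Finset.mul_sum]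
    congr 1
    rw [← Matrix.det_transpose, Matrix.det_apply']
    simp
  · simp

/-! ### Moving the difference operators between the two determinants -/

/-- The determinant whose row `k` is `χ (d k) · (v k)`. -/
def rowDet {n : ℕ} (χ : ℕ → Fin n → ℤ → R) (d : Fin n → ℕ) (v : Fin n → ℤ) : R :=
  Matrix.det (Matrix.of fun k j => χ (d k) j (v k))

theorem rowDet_eq_zero_of_row {n : ℕ} (χ : ℕ → Fin n → ℤ → R) (d : Fin n → ℕ)
    (v : Fin n → ℤ) (k : Fin n) (h : ∀ j, χ (d k) j (v k) = 0) : rowDet χ d v = 0 :=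
  Matrix.det_eq_zero_of_row_eq_zero k h

theorem rowDet_eq_zero_of_eq {n : ℕ} (χ : ℕ → Fin n → ℤ → R) (d : Fin n → ℕ)
    (v : Fin n → ℤ) {k l : Fin n} (hkl : k ≠ l) (hd : d k = d l) (hv : v k = v l) :
    rowDet χ d v = 0 :=
  Matrix.det_zero_of_row_eq hkl (by ext j; simp [hd, hv])

theorem rowDet_sub_mul {n : ℕ} (χ : ℕ → Fin n → ℤ → R) (d : Fin n → ℕ) (v : Fin n → ℤ)
    (k : Fin n) (e : ℕ) (y : ℤ) (t : R)
    (h : ∀ j, χ (d k) j (v k) = χ e j y - t * χ e j (v k)) :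
    rowDet χ d v = rowDet χ (Function.update d k e) (Function.update v k y) -
      t * rowDet χ (Function.update d k e) v := by
  set M : Matrix (Fin n) (Fin n) R := Matrix.of fun k j => χ (d k) j (v k) with hM
  have h0 : M = M.updateRow k ((fun j => χ e j y) + (-t) • fun j => χ e j (v k)) := by
    ext i j
    by_cases hi : i = k
    · subst hi
      simp [hM, h]
      ring
    · simp [hi]
  have h1 : rowDet χ (Function.update d k e) (Function.update v k y) =
      (M.updateRow k fun j => χ e j y).det := by
    unfold rowDet
    congr 1
    ext i j
    by_cases hi : i = k
    · subst hi; simp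
    · simp [hi, hM]
  have h2 : rowDet χ (Function.update d k e) v =
      (M.updateRow k fun j => χ e j (v k)).det := by
    unfold rowDet
    congr 1
    ext i j
    by_cases hi : i = k
    · subst hi; simp
    · simp [hi, hM]
  rw [h1, h2]
  change M.det = _
  rw [h0, Matrix.det_updateRow_add, Matrix.det_updateRow_smul, ← h0]
  ring

/-- The sum over weakly decreasing tuples of a product of two `rowDet`s. -/
def antitoneSum {n : ℕ} (φ ψ : ℕ → Fin n → ℤ → R) (d : Fin n → ℕ) : R :=
  ∑ᶠ v : Fin n → ℤ, if Antitone v then rowDet φ d v * rowDet ψ d v else 0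

theorem hasFiniteSupport_of_box {n : ℕ} (F : (Fin n → ℤ) → R) (a b : Fin n → ℤ)
    (h : ∀ v, F v ≠ 0 → ∀ k, a k ≤ v k ∧ v k ≤ b k) : Function.HasFiniteSupport F :=
  (Set.finite_Icc a b).subset fun v hv => ⟨fun k => (h v hv k).1, fun k => (h v hv k).2⟩

/-- Summation by parts in one variable: the level of row `k` may be lowered by one, provided the
level then agrees with that of the preceding row and agreed before with that of the next one. -/
theorem antitoneSum_update {n : ℕ} (φ ψ : ℕ → Fin n → ℤ → R) (t : ℕ → R) (a b : ℕ → ℤ)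
    (hφ : ∀ m j x, φ m j x = φ (m + 1) j (x + 1) - t m * φ (m + 1) j x)
    (hψ : ∀ m j x, ψ (m + 1) j x = ψ m j (x - 1) - t m * ψ m j x)
    (hφ0 : ∀ m j x, x < a m → φ m j x = 0) (hψ0 : ∀ m j x, b m < x → ψ m j x = 0)
    (d : Fin n → ℕ) (k : Fin n) (e : ℕ) (hk : d k = e + 1)
    (hprev : ∀ i : Fin n, i.1 + 1 = k.1 → d i = e)
    (hnext : ∀ i : Fin n, k.1 + 1 = i.1 → d i = e + 1) :
    antitoneSum φ ψ d = antitoneSum φ ψ (Function.update d k e) := by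
  set d' := Function.update d k e with hd'
  have hd'k : d' k = e := by simp [hd']
  have hd : Function.update d' k (e + 1) = d := by
    rw [hd', Function.update_idem, ← hk, Function.update_eq_self]
  have hψd : ∀ v, rowDet ψ d v =
      rowDet ψ d' (Function.update v k (v k - 1)) - t e * rowDet ψ d' v := fun v =>
    rowDet_sub_mul ψ d v k e _ _ fun j => by rw [hk, hψ]
  have hφd : ∀ v, rowDet φ d' v =
      rowDet φ d (Function.update v k (v k + 1)) - t e * rowDet φ d v := by
    intro v
    have := rowDet_sub_mul φ d' v k (e + 1) (v k + 1) (t e) fun j => by rw [hd'k, hφ]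
    rwa [hd] at this
  have hφz : ∀ v, rowDet φ d v ≠ 0 → ∀ i, a (d i) ≤ v i := by
    intro v hv i
    by_contra! h
    exact hv (rowDet_eq_zero_of_row _ _ _ i fun j => hφ0 _ _ _ h)
  have hψz : ∀ v, rowDet ψ d' v ≠ 0 → ∀ i, v i ≤ b (d' i) := by
    intro v hv i
    by_contra! h
    exact hv (rowDet_eq_zero_of_row _ _ _ i fun j => hψ0 _ _ _ h)
  let up : (Fin n → ℤ) ≃ (Fin n → ℤ) :=
    { toFun := fun v => Function.update v k (v k + 1)
      invFun := fun v => Function.update v k (v k - 1)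
      left_inv := fun v => by simp
      right_inv := fun v => by simp }
  -- the common second term
  let G : (Fin n → ℤ) → R := fun v =>
    if Antitone v then t e * (rowDet φ d v * rowDet ψ d' v) else 0
  have hG : Function.HasFiniteSupport G := by
    refine hasFiniteSupport_of_box _ (fun i => a (d i)) (fun i => b (d' i)) fun v hv i => ?_
    simp only [G] at hv
    refine ⟨hφz v (fun h => hv ?_) i, hψz v (fun h => hv ?_) i⟩ <;> simp [h]
  let A : (Fin n → ℤ) → R := fun v =>
    if Antitone v then rowDet φ d v * rowDet ψ d' (Function.update v k (v k - 1)) else 0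
  have hA : Function.HasFiniteSupport A := by
    refine hasFiniteSupport_of_box _ (fun i => a (d i)) (fun i => b (d' i) + 1)
      fun v hv i => ?_
    simp only [A] at hv
    refine ⟨hφz v (fun h => hv ?_) i, ?_⟩
    · simp [h]
    · have := hψz (Function.update v k (v k - 1)) (fun h => hv (by simp [h])) i
      by_cases hi : i = k
      · subst hi; simp at this; omega
      · simp [hi] at this; omega
  let B : (Fin n → ℤ) → R := fun v =>
    if Antitone v then rowDet φ d (Function.update v k (v k + 1)) * rowDet ψ d' v else 0
  have hB : Function.HasFiniteSupport B := by
    refine hasFiniteSupport_of_box _ (fun i => a (d i) - 1) (fun i => b (d' i))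
      fun v hv i => ?_
    simp only [B] at hv
    refine ⟨?_, hψz v (fun h => hv ?_) i⟩
    · have := hφz (Function.update v k (v k + 1)) (fun h => hv (by simp [h])) i
      by_cases hi : i = k
      · subst hi; simp at this; omega
      · simp [hi] at this; omega
    · simp [h]
  have hAB : ∀ v, A (up v) = B v := by
    intro v
    have hup : up v = Function.update v k (v k + 1) := rfl
    have hback : Function.update (up v) k (up v k - 1) = v := up.left_inv v
    simp only [A, B, hback]
    rw [hup]
    by_cases h1 : Antitone v <;> by_cases h2 : Antitone (Function.update v k (v k + 1))
    · simp [h1, h2]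
    · rw [if_neg h2, if_pos h1]
      suffices rowDet ψ d' v = 0 by simp [this]
      by_cases hk0 : k.1 = 0
      · refine absurd ?_ h2
        intro i j hij
        have := h1 hij
        by_cases hi : i = k <;> by_cases hj : j = k
        · subst hi; subst hj; simp
        · subst hi; simp [hj]; omega
        · subst hj
          have : i = j := Fin.ext (by have : i.1 ≤ j.1 := hij; omega)
          exact absurd this hi
        · simpa [hi, hj] using this
      · let p : Fin n := ⟨k.1 - 1, by omega⟩
        have hp : p.1 + 1 = k.1 := by simp only [p]; omega
        have hpk : p ≠ k := fun h => by rw [h] at hp; omega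
        by_cases hvp : v p = v k
        · exact rowDet_eq_zero_of_eq ψ d' v hpk (by simp [hd', hpk, hprev p hp]) hvp
        · refine absurd ?_ h2
          have hlt : v k < v p := lt_of_le_of_ne
            (h1 (show p.1 ≤ k.1 by omega)) (Ne.symm hvp)
          intro i j hij
          have := h1 hij
          by_cases hi : i = k <;> by_cases hj : j = k
          · subst hi; subst hj; simp
          · subst hi; simp [hj]; omega
          · subst hj
            have hne : i.1 ≠ j.1 := fun h => hi (Fin.ext h)
            have : v p ≤ v i := h1 (show i.1 ≤ p.1 by have : i.1 ≤ j.1 := hij; omega)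
            simp [hi]; omega
          · simpa [hi, hj] using this
    · rw [if_pos h2, if_neg h1]
      suffices rowDet φ d (Function.update v k (v k + 1)) = 0 by simp [this]
      by_cases hkn : k.1 + 1 < n
      · let q : Fin n := ⟨k.1 + 1, hkn⟩
        have hqk : k ≠ q := fun h => by
          have := congrArg Fin.val h
          simp [q] at this
        have hle := h2 (show k ≤ q from Nat.le_succ k.1)
        simp [hqk.symm] at hle
        by_cases hvq : v k + 1 = v q
        · exact rowDet_eq_zero_of_eq φ d _ hqk (by rw [hk, hnext q rfl])
            (by simp [hqk.symm, hvq])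
        · refine absurd ?_ h1
          intro i j hij
          have := h2 hij
          by_cases hi : i = k <;> by_cases hj : j = k
          · subst hi; subst hj; simp
          · subst hi
            have hne : i.1 ≠ j.1 := fun h => hj (Fin.ext h.symm)
            have := h2 (show q.1 ≤ j.1 by
              have : i.1 ≤ j.1 := hij
              change i.1 + 1 ≤ j.1
              omega)
            simp [hj, hqk.symm] at this
            omega
          · subst hj; simp [hi] at this; omega
          · simpa [hi, hj] using this
      · refine absurd ?_ h1
        intro i j hij
        have := h2 hij
        by_cases hi : i = k <;> by_cases hj : j = k
        · subst hi; subst hj; simp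
        · subst hi
          have hne : i.1 ≠ j.1 := fun h => hj (Fin.ext h.symm)
          have : i.1 ≤ j.1 := hij
          omega
        · subst hj; simp [hi] at this; omega
        · simpa [hi, hj] using this
    · simp [h1, h2]
  calc antitoneSum φ ψ d = ∑ᶠ v, (A v - G v) := by
        refine finsum_congr fun v => ?_
        simp only [A, G]
        split_ifs
        · rw [hψd]; ring
        · simp
    _ = ∑ᶠ v, A v - ∑ᶠ v, G v := finsum_sub_distrib hA hG
    _ = ∑ᶠ v, B v - ∑ᶠ v, G v := by
        rw [← finsum_comp_equiv up, finsum_congr hAB]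
    _ = ∑ᶠ v, (B v - G v) := (finsum_sub_distrib hB hG).symm
    _ = antitoneSum φ ψ d' := by
        refine finsum_congr fun v => ?_
        simp only [B, G]
        split_ifs
        · rw [hφd]; ring
        · simp

theorem antitoneSum_eq_zero_level {n : ℕ} (φ ψ : ℕ → Fin n → ℤ → R) (t : ℕ → R) (a b : ℕ → ℤ)
    (hφ : ∀ m j x, φ m j x = φ (m + 1) j (x + 1) - t m * φ (m + 1) j x)
    (hψ : ∀ m j x, ψ (m + 1) j x = ψ m j (x - 1) - t m * ψ m j x)
    (hφ0 : ∀ m j x, x < a m → φ m j x = 0) (hψ0 : ∀ m j x, b m < x → ψ m j x = 0)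
    (d : Fin n → ℕ) (hmono : Monotone d) (hzero : ∀ i : Fin n, i.1 = 0 → d i = 0)
    (hstep : ∀ i j : Fin n, i.1 + 1 = j.1 → d j ≤ d i + 1) :
    antitoneSum φ ψ d = antitoneSum φ ψ fun _ => 0 := by
  induction hs : ∑ i, d i using Nat.strong_induction_on generalizing d with
  | _ s ih =>
    by_cases hd : ∀ i, d i = 0
    · rw [show d = fun _ => 0 from funext hd]
    · push Not at hd
      -- the first row at the top level
      obtain ⟨l, -, hl⟩ := Finset.exists_max_image (Finset.univ : Finset (Fin n)) d
        ⟨hd.choose, Finset.mem_univ _⟩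
      obtain ⟨k, hkl, hkmin⟩ : ∃ k, d k = d l ∧ ∀ i < k, d i ≠ d l := by
        have hne : (Finset.univ.filter fun i => d i = d l).Nonempty := ⟨l, by simp⟩
        refine ⟨Finset.min' _ hne, (Finset.mem_filter.1 (Finset.min'_mem _ hne)).2, ?_⟩
        intro i hi h
        exact absurd (Finset.min'_le _ i (by simp [h])) (not_le.2 hi)
      have hmax : ∀ i, d i ≤ d k := fun i => hkl ▸ hl i (Finset.mem_univ _)
      have hkpos : d k ≠ 0 := by
        obtain ⟨i, hi⟩ := hd
        have := hmax i
        omega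
      obtain ⟨e, he⟩ := Nat.exists_eq_succ_of_ne_zero hkpos
      have hlt : ∀ i, i < k → d i ≤ e := fun i hi => by
        have h1 := hkmin i hi
        have h2 := hmax i
        omega
      have hge : ∀ i, k ≤ i → d i = e + 1 := fun i hi => by
        have h1 := hmono hi
        have h2 := hmax i
        omega
      have hprev : ∀ i : Fin n, i.1 + 1 = k.1 → d i = e := fun i hi => by
        have h1 := hstep i k hi
        have h2 := hlt i (show i.1 < k.1 by omega)
        omega
      rw [antitoneSum_update φ ψ t a b hφ hψ hφ0 hψ0 d k e he hprev
        fun i hi => hge i (show k.1 ≤ i.1 by omega)]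
      refine ih _ ?_ _ ?_ ?_ ?_ rfl
      · rw [← hs]
        refine Finset.sum_lt_sum (fun i _ => ?_) ⟨k, Finset.mem_univ _, by simp [he]⟩
        by_cases hi : i = k
        · subst hi; simp [he]
        · simp [hi]
      · intro i j hij
        by_cases hi : i = k <;> by_cases hj : j = k
        · subst hi; subst hj; simp
        · subst hi; have := hge j hij; simp [hj, this]
        · subst hj; have := hlt i (lt_of_le_of_ne hij hi); simpa [hi] using this
        · simpa [hi, hj] using hmono hij
      · intro i hi
        by_cases hik : i = k
        · subst hik
          exact absurd (hzero i hi) hkpos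
        · simpa [hik] using hzero i hi
      · intro i j hij
        have h := hstep i j hij
        by_cases hi : i = k <;> by_cases hj : j = k
        · subst hi; subst hj; simp
        · subst hi; have := hge j (show i.1 ≤ j.1 by omega); simp [hj, this]
        · subst hj; have := hprev i hij; simp [hi, this]
        · simpa [hi, hj] using h

/-- The determinant of convolutions as a sum over weakly decreasing tuples, all rows being at
level zero. -/
theorem antitoneSum_zero {n : ℕ} (φ ψ : ℕ → Fin n → ℤ → R) (a b : ℕ → ℤ)
    (hφ0 : ∀ m j x, x < a m → φ m j x = 0) (hψ0 : ∀ m j x, b m < x → ψ m j x = 0) :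
    antitoneSum φ ψ (fun _ => 0) =
      Matrix.det (Matrix.of fun i j => ∑ᶠ x, ψ 0 i x * φ 0 j x) := by
  have hsum : ∀ i j, ∑ᶠ x, ψ 0 i x * φ 0 j x =
      ∑ x ∈ Finset.Icc (a 0) (b 0), ψ 0 i x * φ 0 j x := fun i j => by
    refine finsum_eq_sum_of_support_subset _ fun x hx => ?_
    simp only [Finset.coe_Icc, Set.mem_Icc]
    constructor
    · by_contra! h
      exact hx (by simp [hφ0 0 j x h])
    · by_contra! h
      exact hx (by simp [hψ0 0 i x h])
  simp only [hsum]
  rw [← det_sum_mul_eq_sum_antitone]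
  refine finsum_eq_sum_of_support_subset _ fun v hv => ?_
  simp only [Finset.mem_coe, Fintype.mem_piFinset, Finset.mem_Icc]
  intro i
  constructor
  · by_contra! h
    exact hv (by simp [rowDet_eq_zero_of_row φ (fun _ => 0) v i fun j => hφ0 _ _ _ h])
  · by_contra! h
    exact hv (by simp [rowDet_eq_zero_of_row ψ (fun _ => 0) v i fun j => hψ0 _ _ _ h])

/-! ### The operators as multiplication by Laurent series -/

theorem conv_coeff (F G : LaurentSeries R) : conv F.coeff G.coeff = (F * G).coeff := by
  funext x
  rw [HahnSeries.coeff_mul]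
  unfold conv
  have hsupp : (Function.support fun y => F.coeff (x - y) * G.coeff y) ⊆
      ((Finset.antidiagonal F.isPWO_support G.isPWO_support x).image Prod.snd : Finset ℤ) := by
    intro y hy
    simp only [Finset.coe_image, Set.mem_image, Finset.mem_coe, Finset.mem_antidiagonal]
    refine ⟨(x - y, y), ⟨?_, ?_, by simp⟩, rfl⟩
    · exact fun h => hy (by simp [h])
    · exact fun h => hy (by simp [h])
  rw [finsum_eq_sum_of_support_subset _ hsupp, Finset.sum_image]
  · refine Finset.sum_congr rfl fun p hp => ?_
    rw [Finset.mem_antidiagonal] at hp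
    rw [← hp.2.2, add_sub_cancel_right]
  · intro p hp q hq h
    simp only [Finset.mem_coe, Finset.mem_antidiagonal] at hp hq
    exact Prod.ext (by have := hp.2.2; have := hq.2.2; omega) h

/-- The symbol `z⁻¹ - t` of `Dop t`. -/
def dopSymbol (t : R) : LaurentSeries R := HahnSeries.single (-1) 1 - HahnSeries.C t

/-- The symbol `∑_{k ≥ 1} t^{k-1} z^k` of `Dinv t`. -/
def dinvSymbol (t : R) : LaurentSeries R :=
  HahnSeries.ofSuppBddBelow (fun x : ℤ => if 0 < x then t ^ (x - 1).toNat else 0)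
    (show BddBelow _ from ⟨0, fun x hx => by
      by_contra! h
      exact hx (if_neg (by omega))⟩)

theorem dinvSymbol_coeff (t : R) (x : ℤ) :
    (dinvSymbol t).coeff x = if 0 < x then t ^ (x - 1).toNat else 0 :=
  rfl

theorem Dop_coeff (t : R) (F : LaurentSeries R) : Dop t F.coeff = (dopSymbol t * F).coeff := by
  funext x
  have h : (HahnSeries.single (-1 : ℤ) (1 : R) * F).coeff x = F.coeff (x + 1) := by
    rw [HahnSeries.coeff_single_mul]
    simp
  simp [Dop, dopSymbol, sub_mul, HahnSeries.coeff_sub, h]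

theorem Dinv_coeff (t : R) (F : LaurentSeries R) : Dinv t F.coeff = (F * dinvSymbol t).coeff := by
  rw [← conv_coeff]
  funext x
  unfold Dinv conv
  rw [← finsum_comp_equiv (Equiv.subLeft x)]
  refine finsum_congr fun y => ?_
  simp only [dinvSymbol_coeff, Equiv.subLeft_apply]
  by_cases h : 0 < y
  · rw [if_pos (by omega), if_pos h, mul_comm, show x - 1 - (x - y) = y - 1 by ring]
  · rw [if_neg (by omega), if_neg h, mul_zero]

theorem dopSymbol_mul_dinvSymbol (t : R) : dopSymbol t * dinvSymbol t = 1 := by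
  ext x
  rw [← Dop_coeff, HahnSeries.coeff_one]
  simp only [Dop, dinvSymbol_coeff]
  rcases lt_trichotomy x 0 with h | h | h
  · rw [if_neg (by omega), if_neg (by omega), if_neg (by omega)]
    simp
  · subst h
    simp
  · rw [if_pos (by omega), if_pos h, if_neg (by omega),
      show (x + 1 - 1).toNat = (x - 1).toNat + 1 by omega, pow_succ']
    ring

/-- `dopSymbol t` as a unit. -/
def dopUnit (t : R) : (LaurentSeries R)ˣ where
  val := dopSymbol t
  inv := dinvSymbol t
  val_inv := dopSymbol_mul_dinvSymbol t
  inv_val := by rw [mul_comm]; exact dopSymbol_mul_dinvSymbol t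

/-- The product of the symbols of `Dop (t 0), …, Dop (t (m - 1))`. -/
def dopProd (t : ℕ → R) (m : ℕ) : (LaurentSeries R)ˣ := ∏ i ∈ Finset.range m, dopUnit (t i)

theorem dopProd_succ (t : ℕ → R) (m : ℕ) : dopProd t (m + 1) = dopProd t m * dopUnit (t m) :=
  Finset.prod_range_succ _ _

theorem DopIter_coeff (t : ℕ → R) (m k : ℕ) (F : LaurentSeries R) :
    DopIter t m k F.coeff =
      (((dopProd t m)⁻¹ * dopProd t (m + k) : (LaurentSeries R)ˣ) * F).coeff := by
  induction k generalizing m with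
  | zero => simp [DopIter]
  | succ k ih =>
    simp only [DopIter]
    rw [ih, Dop_coeff, ← mul_assoc]
    change (((dopUnit (t m) : (LaurentSeries R)ˣ) : LaurentSeries R) * _ * F).coeff = _
    rw [← Units.val_mul, dopProd_succ, show m + 1 + k = m + (k + 1) by ring]
    congr 3
    rw [mul_inv_rev, mul_assoc, mul_inv_cancel_left]

theorem DinvIter_coeff (t : ℕ → R) (m k : ℕ) (F : LaurentSeries R) :
    DinvIter t m k F.coeff =
      (((dopProd t (m + k))⁻¹ * dopProd t m : (LaurentSeries R)ˣ) * F).coeff := by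
  induction k generalizing m with
  | zero => simp [DinvIter]
  | succ k ih =>
    simp only [DinvIter]
    rw [ih, Dinv_coeff, mul_comm, ← mul_assoc]
    change ((((dopUnit (t m))⁻¹ : (LaurentSeries R)ˣ) : LaurentSeries R) * _ * F).coeff = _
    rw [← Units.val_mul, dopProd_succ, show m + 1 + k = m + (k + 1) by ring]
    congr 3
    rw [mul_left_comm, mul_comm (dopProd t m), inv_mul_cancel_left]

theorem Dmulti_coeff (t : ℕ → R) (i j : ℕ) (F : LaurentSeries R) :
    Dmulti t i j F.coeff =
      (((dopProd t i)⁻¹ * dopProd t j : (LaurentSeries R)ˣ) * F).coeff := by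
  unfold Dmulti
  split_ifs with h
  · rw [DopIter_coeff, Nat.add_sub_cancel' h]
  · rw [DinvIter_coeff, Nat.add_sub_cancel' (by omega)]

theorem Dop_Dmulti_succ_left (t : ℕ → R) (i j : ℕ) (F : LaurentSeries R) :
    Dop (t i) (Dmulti t (i + 1) j F.coeff) = Dmulti t i j F.coeff := by
  rw [Dmulti_coeff, Dmulti_coeff, Dop_coeff, ← mul_assoc]
  change (((dopUnit (t i) : (LaurentSeries R)ˣ) : LaurentSeries R) * _ * F).coeff = _
  rw [← Units.val_mul, dopProd_succ]
  congr 3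
  rw [mul_inv_rev, mul_assoc, mul_inv_cancel_left]

theorem Dop_Dmulti_right (t : ℕ → R) (i j : ℕ) (F : LaurentSeries R) :
    Dop (t j) (Dmulti t i j F.coeff) = Dmulti t i (j + 1) F.coeff := by
  rw [Dmulti_coeff, Dmulti_coeff, Dop_coeff, ← mul_assoc]
  change (((dopUnit (t j) : (LaurentSeries R)ˣ) : LaurentSeries R) * _ * F).coeff = _
  rw [← Units.val_mul, dopProd_succ]
  congr 3
  rw [mul_left_comm, mul_comm (dopUnit _)]

theorem conv_Dmulti_Dmulti (t : ℕ → R) (i j k : ℕ) (F G : LaurentSeries R) :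
    conv (Dmulti t k j F.coeff) (Dmulti t i k G.coeff) = Dmulti t i j (conv F.coeff G.coeff) := by
  rw [conv_coeff, Dmulti_coeff, Dmulti_coeff, Dmulti_coeff, conv_coeff, mul_mul_mul_comm,
    ← Units.val_mul]
  congr 3
  rw [mul_comm, mul_assoc, mul_inv_cancel_left]

theorem LaurentSeries.exists_forall_lt_coeff_eq_zero (F : LaurentSeries R) :
    ∃ c : ℤ, ∀ x < c, F.coeff x = 0 :=
  ⟨F.order, fun _ hx => HahnSeries.coeff_eq_zero_of_lt_order hx⟩

theorem exists_Dmulti_support_bound {n : ℕ} (t : ℕ → R) (F : LaurentSeries R)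
    (p q : Fin n → ℕ) :
    ∃ c : ℤ, ∀ i, ∀ x < c, Dmulti t (p i) (q i) F.coeff x = 0 := by
  have h := fun i => LaurentSeries.exists_forall_lt_coeff_eq_zero
    ((((dopProd t (p i))⁻¹ * dopProd t (q i) : (LaurentSeries R)ˣ) : LaurentSeries R) * F)
  choose c hc using h
  obtain ⟨m, hm⟩ := (Set.finite_range c).bddBelow
  refine ⟨m, fun i x hx => ?_⟩
  rw [Dmulti_coeff]
  exact hc i x (hx.trans_le (hm ⟨i, rfl⟩))

/-- **Convolution determinant lemma** (refined version of Johansson's Lemma 3.2).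
For `f, g : ℤ → R` vanishing below some `M` and partitions `λ, μ` with at most
`ℓ` parts:
`Σ_{ν_ℓ ≤ ⋯ ≤ ν_1} det[ Δ_t^{j-i} f(ν_i - μ_j) ] det[ Δ_t^{j-i} g(λ_i - ν_j) ]
   = det[ (Δ_t^{j-i}(f∗g))(λ_i - μ_j) ]`,
the sum over weakly decreasing integer tuples having finitely many nonzero
terms. -/
theorem det_convolution_lemma
    {R : Type*} [CommRing R] (ℓ : ℕ) (hl : 1 ≤ ℓ) (t : ℕ → R) (f g : ℤ → R)
    (M : ℤ) (hf : ∀ ν : ℤ, ν < M → f ν = 0) (hg : ∀ ν : ℤ, ν < M → g ν = 0)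
    (lam mu : ℕ → ℕ)
    (hlam : ∀ a b : ℕ, a ≤ b → b < ℓ → lam b ≤ lam a)
    (hmu : ∀ a b : ℕ, a ≤ b → b < ℓ → mu b ≤ mu a) :
    (∑ᶠ ν : Fin ℓ → ℤ,
      if ∀ i j : Fin ℓ, (i : ℕ) ≤ (j : ℕ) → ν j ≤ ν i then
        Matrix.det (Matrix.of fun i j : Fin ℓ =>
            Dmulti t (i.1 + 1) (j.1 + 1) f (ν i - (mu j.1 : ℤ))) *
          Matrix.det (Matrix.of fun i j : Fin ℓ =>
            Dmulti t (i.1 + 1) (j.1 + 1) g ((lam i.1 : ℤ) - ν j))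
      else 0) =
      Matrix.det (Matrix.of fun i j : Fin ℓ =>
        Dmulti t (i.1 + 1) (j.1 + 1) (conv f g)
          ((lam i.1 : ℤ) - (mu j.1 : ℤ))) := by
  obtain ⟨F, rfl⟩ : ∃ F : LaurentSeries R, F.coeff = f :=
    ⟨HahnSeries.ofSuppBddBelow f ⟨M, fun x hx => by by_contra! h; exact hx (hf x h)⟩, rfl⟩
  obtain ⟨G, rfl⟩ : ∃ G : LaurentSeries R, G.coeff = g :=
    ⟨HahnSeries.ofSuppBddBelow g ⟨M, fun x hx => by by_contra! h; exact hx (hg x h)⟩, rfl⟩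
  let φ : ℕ → Fin ℓ → ℤ → R := fun m j x => Dmulti t (m + 1) (j.1 + 1) F.coeff (x - mu j.1)
  let ψ : ℕ → Fin ℓ → ℤ → R := fun m i x => Dmulti t (i.1 + 1) (m + 1) G.coeff (lam i.1 - x)
  have hφ : ∀ m j x, φ m j x = φ (m + 1) j (x + 1) - t (m + 1) * φ (m + 1) j x := by
    intro m j x
    simp only [φ]
    rw [← Dop_Dmulti_succ_left t (m + 1), Dop, show x - (mu j.1 : ℤ) + 1 = x + 1 - mu j.1 by ring]
  have hψ : ∀ m i x, ψ (m + 1) i x = ψ m i (x - 1) - t (m + 1) * ψ m i x := by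
    intro m i x
    simp only [ψ]
    rw [← Dop_Dmulti_right t _ (m + 1), Dop,
      show (lam i.1 : ℤ) - x + 1 = lam i.1 - (x - 1) by ring]
  have hφb : ∀ m, ∃ a : ℤ, ∀ j x, x < a → φ m j x = 0 := by
    intro m
    obtain ⟨c, hc⟩ := exists_Dmulti_support_bound t F (fun _ : Fin ℓ => m + 1) fun j => j.1 + 1
    exact ⟨c, fun j x hx => hc j _ (by omega)⟩
  have hψb : ∀ m, ∃ b : ℤ, ∀ i x, b < x → ψ m i x = 0 := by
    intro m
    obtain ⟨c, hc⟩ := exists_Dmulti_support_bound t G (fun i : Fin ℓ => i.1 + 1) fun _ => m + 1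
    obtain ⟨B, hB⟩ := (Set.finite_range fun i : Fin ℓ => (lam i.1 : ℤ)).bddAbove
    refine ⟨B - c, fun i x hx => hc i _ ?_⟩
    have : (lam i.1 : ℤ) ≤ B := hB ⟨i, rfl⟩
    omega
  choose a hφ0 using hφb
  choose b hψ0 using hψb
  have key := (antitoneSum_eq_zero_level φ ψ (fun m => t (m + 1)) a b hφ hψ hφ0 hψ0
    (fun i => i.1) (fun _ _ h => h) (fun _ h => h) (fun _ _ h => h.ge)).trans
    (antitoneSum_zero φ ψ a b hφ0 hψ0)
  have hconv : ∀ i j : Fin ℓ, ∑ᶠ x, ψ 0 i x * φ 0 j x =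
      Dmulti t (i.1 + 1) (j.1 + 1) (conv F.coeff G.coeff) ((lam i.1 : ℤ) - (mu j.1 : ℤ)) := by
    intro i j
    rw [← conv_Dmulti_Dmulti t _ _ 1, conv, ← finsum_comp_equiv (Equiv.subLeft (lam i.1 : ℤ))]
    refine finsum_congr fun x => ?_
    simp only [φ, ψ, Equiv.subLeft_apply, zero_add]
    rw [mul_comm, sub_sub_cancel, sub_right_comm]
  simp only [hconv] at key
  rw [← key]
  refine finsum_congr fun v => if_congr Iff.rfl ?_ rfl
  congr 1
  exact (Matrix.det_transpose _).symm

end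
end
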